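/- arXiv:2111.03034 — 3 statements merged into one kernel-verified Lean document; each statement's English description precedes it below -/
import Mathlib

section
/- Let μ be a distribution over {-1,+1}^V and η > 0. If μ is η-spectrally independent in ∞-norm with all fields, then for every θ ∈ (0,1), μ satisfies θ-magnetized block factorization of entropy with parameter C = (e/θ)^{η+3}. -/
open Classical Finset

noncomputable section

namespace PaperIsing

/-- A configuration assigns to each vertex a spin; `true` encodes `+1`, `false` encodes `-1`. -/
abbrev Conf (V : Type*) := V → Bool

variable {V : Type*} [Fintype V] [DecidableEq V]

/-- `μ` is a probability distribution on the finite type `A`. -/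
def IsDist {A : Type*} [Fintype A] (μ : A → ℝ) : Prop :=
  (∀ a, 0 ≤ μ a) ∧ ∑ a, μ a = 1

/-- Entropy functional `Ent_μ[f] = E_μ[f log f] − E_μ[f] log E_μ[f]`
(the convention `0 log 0 = 0` holds since `Real.log 0 = 0`). -/
def entOf {A : Type*} [Fintype A] (μ f : A → ℝ) : ℝ :=
  (∑ a, μ a * (f a * Real.log (f a))) - (∑ a, μ a * f a) * Real.log (∑ a, μ a * f a)

/-- KL divergence `KL(ν‖μ)`. -/
def klDivF {A : Type*} [Fintype A] (ν μ : A → ℝ) : ℝ :=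
  ∑ a, ν a * Real.log (ν a / μ a)

/-- The covariance of `f` and `log f` with respect to `ν`. -/
def ment {A : Type*} [Fintype A] (ν f : A → ℝ) : ℝ :=
  (1/2) * ∑ σ : A, ∑ τ : A, ν σ * ν τ * (f σ - f τ) * (Real.log (f σ) - Real.log (f τ))

/-- Total variation distance between two distributions on a finite type. -/
def tvDist {A : Type*} [Fintype A] (p q : A → ℝ) : ℝ :=
  (1/2) * ∑ a, |p a - q a|

/-- The set of `+1` vertices of a configuration. -/
def plusSet (σ : Conf V) : Finset V := Finset.univ.filter (fun v => σ v = true)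

/-- `‖σ‖₊`, the number of `+1` spins. -/
def plusCount (σ : Conf V) : ℕ := (plusSet σ).card

/-- Marginal probability, under `μ`, that the configuration agrees with `τ` on `Λ`. -/
def margin (μ : Conf V → ℝ) (Λ : Finset V) (τ : Conf V) : ℝ :=
  ∑ σ : Conf V, if ∀ v ∈ Λ, σ v = τ v then μ σ else 0

/-- `μ` conditioned on agreeing with `τ` on `Λ`. -/
def condDist (μ : Conf V → ℝ) (Λ : Finset V) (τ : Conf V) : Conf V → ℝ :=
  fun σ => if ∀ v ∈ Λ, σ v = τ v then μ σ / margin μ Λ τ else 0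

/-- Transition matrix of the Glauber dynamics for `μ`:
pick `v` uniformly, resample the spin at `v` from the conditional marginal. -/
def glauber (μ : Conf V → ℝ) (σ τ : Conf V) : ℝ :=
  (Fintype.card V : ℝ)⁻¹ * ∑ v : V, condDist μ (Finset.univ.erase v) σ τ

/-- Dirichlet form `E_P(f, log f) = ⟨f, (I−P) log f⟩_μ` for the Glauber dynamics `P` on `μ`. -/
def dirichletLog (μ f : Conf V → ℝ) : ℝ :=
  ∑ σ : Conf V, μ σ * f σ * (Real.log (f σ) - ∑ τ : Conf V, glauber μ σ τ * Real.log (f τ))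

/-- Modified log-Sobolev constant of the Glauber dynamics on `μ`. -/
def mlsConst (μ : Conf V → ℝ) : ℝ :=
  sInf {r : ℝ | ∃ f : Conf V → ℝ, (∀ σ, 0 ≤ f σ) ∧ entOf μ f ≠ 0 ∧
    r = dirichletLog μ f / entOf μ f}

/-- Modified log-Sobolev constant under the worst pinning. -/
def mlsMin (μ : Conf V → ℝ) : ℝ :=
  sInf {r : ℝ | ∃ (Λ : Finset V) (τ : Conf V), 0 < margin μ Λ τ ∧
    r = mlsConst (condDist μ Λ τ)}

/-- Imposing local fields `lam` on `μ`: `μ^(λ)(σ) ∝ μ(σ) ∏_{v : σ_v = +1} λ_v`. -/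
def magnetize (μ : Conf V → ℝ) (lam : V → ℝ) : Conf V → ℝ :=
  fun σ => (μ σ * ∏ v : V, if σ v then lam v else 1) /
    (∑ τ : Conf V, μ τ * ∏ v : V, if τ v then lam v else 1)

/-- Imposing the constant local field `θ`. -/
def magnetizeC (μ : Conf V → ℝ) (θ : ℝ) : Conf V → ℝ :=
  magnetize μ (fun _ => θ)

/-- `Z_π = ∑_σ μ(σ) θ^{‖σ‖₊}`. -/
def Zmag (μ : Conf V → ℝ) (θ : ℝ) : ℝ :=
  ∑ σ : Conf V, μ σ * θ ^ plusCount σ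

/-- `Pr_μ[σ_v = +1 ∣ σ_u = b]`. -/
def condPlusProb (μ : Conf V → ℝ) (u : V) (b : Bool) (v : V) : ℝ :=
  (∑ σ : Conf V, if σ u = b ∧ σ v = true then μ σ else 0) /
  (∑ σ : Conf V, if σ u = b then μ σ else 0)

/-- Signed influence matrix `Ψ^inf_μ(u,v)`. -/
def infl (μ : Conf V → ℝ) (u v : V) : ℝ :=
  if u ≠ v ∧ 0 < (∑ σ : Conf V, if σ u = true then μ σ else 0) ∧
      0 < (∑ σ : Conf V, if σ u = false then μ σ else 0)
  then condPlusProb μ u true v - condPlusProb μ u false v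
  else 0

/-- `μ` is `η`-spectrally independent in `∞`-norm. -/
def SIinf (μ : Conf V → ℝ) (η : ℝ) : Prop :=
  ∀ u : V, ∑ v : V, |infl μ u v| ≤ η

/-- `μ` is `η`-spectrally independent in `∞`-norm with all fields. -/
def SIinfAllFields (μ : Conf V → ℝ) (η : ℝ) : Prop :=
  ∀ lam : V → ℝ, (∀ v, 0 < lam v) → SIinf (magnetize μ lam) η

/-- The projection `σ ↦ σ*` from configurations on `V × [k]` to configurations on `V`. -/
def kstar {k : ℕ} (τ : Conf (V × Fin k)) : Conf V :=
  fun v => decide (∃ i : Fin k, τ (v, i) = true)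

/-- The `k`-transformation `μ_k = Trans(μ, k)` of `μ`. -/
def ktrans (μ : Conf V → ℝ) (k : ℕ) : Conf (V × Fin k) → ℝ :=
  fun τ =>
    if ∀ v : V, (Finset.univ.filter (fun i : Fin k => τ (v, i) = true)).card ≤ 1
    then μ (kstar τ) * ((k : ℝ)⁻¹) ^ plusCount (kstar τ)
    else 0

/-- Probability of the subset `R` under `Bin(V, 1−θ)`. -/
def binWeight (θ : ℝ) (R : Finset V) : ℝ :=
  (1 - θ) ^ R.card * θ ^ (Fintype.card V - R.card)

/-- The term `π_R(𝟙_R) ⬝ Ent_{π^{𝟙_R}}[f]` with `π = μ^(θ)`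
(when `π_R(𝟙_R) = 0` this product is `0`, matching the convention). -/
def mbfTerm (μ : Conf V → ℝ) (θ : ℝ) (f : Conf V → ℝ) (R : Finset V) : ℝ :=
  margin (magnetizeC μ θ) R (fun _ => true) *
    entOf (condDist (magnetizeC μ θ) R (fun _ => true)) f

/-- `θ`-magnetized block factorization of entropy with parameter `C`. -/
def MBF (μ : Conf V → ℝ) (θ C : ℝ) : Prop :=
  ∀ f : Conf V → ℝ, (∀ σ, 0 ≤ f σ) →
    entOf μ f ≤ C * (Zmag μ θ / θ ^ (Fintype.card V)) *
      ∑ R : Finset V, binWeight θ R * mbfTerm μ θ f R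

/-- `ν[Ent_S[f]] = ∑_{σ ∈ Ω(ν_{W∖S})} ν_{W∖S}(σ) Ent_{ν^σ}[f]`, with canonical
representatives `χ` vanishing on `S`. -/
def avgEnt {W : Type*} [Fintype W] [DecidableEq W]
    (ν : Conf W → ℝ) (S : Finset W) (f : Conf W → ℝ) : ℝ :=
  ∑ χ : Conf W, if ∀ v ∈ S, χ v = false
    then margin ν (Finset.univ \ S) χ * entOf (condDist ν (Finset.univ \ S) χ) f
    else 0

/-- `ℓ`-uniform block factorization of entropy with parameter `C`. -/
def UBF {W : Type*} [Fintype W] [DecidableEq W]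
    (ν : Conf W → ℝ) (ℓ : ℕ) (C : ℝ) : Prop :=
  ∀ f : Conf W → ℝ, (∀ σ, 0 ≤ f σ) →
    entOf ν f ≤ (C / (Nat.choose (Fintype.card W) ℓ : ℝ)) *
      ∑ S ∈ Finset.powersetCard ℓ (Finset.univ : Finset W), avgEnt ν S f

/-- The down walk applied to a distribution: `(ν D_{k→j})(β) = Σ_{α ⊇ β} ν(α)/C(k,j)`
for `|β| = j`. -/
def downDist {U : Type*} [Fintype U] [DecidableEq U]
    (ν : Finset U → ℝ) (k j : ℕ) : Finset U → ℝ :=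
  fun β => if β.card = j
    then (∑ α : Finset U, if β ⊆ α ∧ α.card = k then ν α else 0) / (Nat.choose k j : ℝ)
    else 0

/-- The up walk applied to a function:
`(U_{j→k} f)(α) = (Σ_{β ⊇ α} μ(β) f(β)) / (Σ_{γ ⊇ α} μ(γ))` for `μ` supported on size-`k` sets. -/
def upFun {U : Type*} [Fintype U] [DecidableEq U]
    (μ f : Finset U → ℝ) : Finset U → ℝ :=
  fun α => (∑ β : Finset U, if α ⊆ β then μ β * f β else 0) /
    (∑ γ : Finset U, if α ⊆ γ then μ γ else 0)

/-- The multivariate hypergeometric distribution `HG(V, k, ℓ)`. -/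
def hyperGeo (V : Type*) [Fintype V] (k ℓ : ℕ) (a : V → ℕ) : ℝ :=
  if ∑ v, a v = ℓ
  then (∏ v, (Nat.choose k (a v) : ℝ)) / (Nat.choose (k * Fintype.card V) ℓ : ℝ)
  else 0

/-- The flipped distribution `flip(μ, χ)(σ) = μ(σ ⊙ χ)`, where `(σ ⊙ χ)_v = σ_v χ_v`. -/
def flipDist (μ : Conf V → ℝ) (χ : Conf V) : Conf V → ℝ :=
  fun σ => μ (fun v => σ v == χ v)

/-- The number of monochromatic edges of `G` under `σ`. -/
def monoCount (G : SimpleGraph V) (σ : Conf V) : ℕ :=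
  (Finset.univ.filter (fun e : Sym2 V =>
    e ∈ G.edgeSet ∧ ∀ a ∈ e, ∀ b ∈ e, σ a = σ b)).card

/-- The Gibbs distribution of the Ising model `(G, β, λ)`. -/
def isingGibbs (G : SimpleGraph V) (β : ℝ) (lam : V → ℝ) : Conf V → ℝ :=
  fun σ => (β ^ monoCount G σ * ∏ v : V, if σ v then lam v else 1) /
    (∑ τ : Conf V, β ^ monoCount G τ * ∏ v : V, if τ v then lam v else 1)

/-- Distribution of the Glauber dynamics on `μ` after `t` steps, started from initial
distribution `ν`. -/
def chainDist (μ ν : Conf V → ℝ) : ℕ → Conf V → ℝ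
  | 0 => ν
  | (t+1) => fun τ => ∑ σ : Conf V, chainDist μ ν t σ * glauber μ σ τ

/-- `‖Ψ^inf_μ‖_∞ = max_u Σ_v |Ψ^inf_μ(u,v)|`. -/
def psiNorm [Nonempty V] (μ : Conf V → ℝ) : ℝ :=
  Finset.univ.sup' Finset.univ_nonempty (fun u => ∑ v : V, |infl μ u v|)

end PaperIsing

open PaperIsing

section helpers
variable {V : Type*} [Fintype V] [DecidableEq V]

def ylin (y : V → ℝ) (σ : Conf V) : ℝ := ∑ v, if σ v = true then y v else 0

def Quad (k : ℝ) (W : Conf V → ℝ) : Prop :=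
  ∀ y : V → ℝ, (∑ σ, W σ) * (∑ σ, W σ * (ylin y σ) ^ 2) - (∑ σ, W σ * ylin y σ) ^ 2 ≤
    k * ((∑ σ, W σ) * ∑ σ, W σ * ylin (fun v => y v ^ 2) σ)

def pm (W : Conf V → ℝ) (u : V) : ℝ := ∑ σ : Conf V, if σ u = true then W σ else 0

def jm (W : Conf V → ℝ) (u v : V) : ℝ :=
  ∑ σ : Conf V, if σ u = true ∧ σ v = true then W σ else 0

lemma sum_ylin (W : Conf V → ℝ) (y : V → ℝ) :
    ∑ σ, W σ * ylin y σ = ∑ v, y v * pm W v := by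
  simp only [ylin, pm, Finset.mul_sum]
  rw [Finset.sum_comm]
  refine Finset.sum_congr rfl fun v _ => Finset.sum_congr rfl fun σ _ => ?_
  split_ifs <;> ring

lemma sum_ylin_sq (W : Conf V → ℝ) (y : V → ℝ) :
    ∑ σ, W σ * ylin y σ ^ 2 = ∑ u, ∑ v, y u * y v * jm W u v := by
  have : ∀ σ, W σ * ylin y σ ^ 2 =
      ∑ u, ∑ v, y u * y v * (if σ u = true ∧ σ v = true then W σ else 0) := by
    intro σ
    rw [ylin, sq, Finset.sum_mul_sum, Finset.mul_sum]
    refine Finset.sum_congr rfl fun u _ => ?_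
    rw [Finset.mul_sum]
    refine Finset.sum_congr rfl fun v _ => ?_
    by_cases h1 : σ u = true <;> by_cases h2 : σ v = true <;> simp [h1, h2] <;> ring
  simp only [this, jm, Finset.mul_sum]
  rw [Finset.sum_comm]
  refine Finset.sum_congr rfl fun u _ => ?_
  rw [Finset.sum_comm]

lemma cov_bound (W : Conf V → ℝ) (hW : IsDist W) (u v : V) (huv : u ≠ v) :
    |jm W u v - pm W u * pm W v| ≤ pm W u * |infl W u v| := by
  have hQ : (∑ σ : Conf V, if σ u = false then W σ else 0) = 1 - pm W u := by
    rw [← hW.2, pm, ← Finset.sum_sub_distrib]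
    refine Finset.sum_congr rfl fun σ _ => ?_
    cases σ u <;> simp
  have hJ : (∑ σ : Conf V, if σ u = false ∧ σ v = true then W σ else 0)
      = pm W v - jm W u v := by
    rw [pm, jm, ← Finset.sum_sub_distrib]
    refine Finset.sum_congr rfl fun σ _ => ?_
    cases σ u <;> simp
  have hP0 : 0 ≤ pm W u := Finset.sum_nonneg fun σ _ => by
    split_ifs; exacts [hW.1 _, le_rfl]
  have hQ0 : 0 ≤ 1 - pm W u := by
    rw [← hQ]; exact Finset.sum_nonneg fun σ _ => by split_ifs; exacts [hW.1 _, le_rfl]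
  have hJ0 : 0 ≤ jm W u v := Finset.sum_nonneg fun σ _ => by
    split_ifs; exacts [hW.1 _, le_rfl]
  have hJ1 : jm W u v ≤ pm W u := Finset.sum_le_sum fun σ _ => by
    have := hW.1 σ
    cases σ u <;> cases σ v <;> simp [this]
  have hJ2 : 0 ≤ pm W v - jm W u v := by
    rw [← hJ]; exact Finset.sum_nonneg fun σ _ => by split_ifs; exacts [hW.1 _, le_rfl]
  have hJ3 : pm W v - jm W u v ≤ 1 - pm W u := by
    rw [← hJ, ← hQ]
    exact Finset.sum_le_sum fun σ _ => by
      have := hW.1 σ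
      cases σ u <;> cases σ v <;> simp [this]
  by_cases h : 0 < pm W u ∧ 0 < 1 - pm W u
  · have hi : infl W u v = (jm W u v - pm W u * pm W v) / (pm W u * (1 - pm W u)) := by
      have h1 : u ≠ v ∧ 0 < (∑ σ : Conf V, if σ u = true then W σ else 0) ∧
        0 < (∑ σ : Conf V, if σ u = false then W σ else 0) :=
        ⟨huv, h.1, by rw [hQ]; exact h.2⟩
      rw [infl, if_pos h1, condPlusProb, condPlusProb, hQ, hJ]
      change jm W u v / pm W u - _ = _
      have := h.1.ne'
      have := h.2.ne'
      field_simp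
      ring
    rw [hi, abs_div, abs_of_pos (mul_pos h.1 h.2)]
    rw [mul_div_assoc', le_div_iff₀ (mul_pos h.1 h.2)]
    have := abs_nonneg (jm W u v - pm W u * pm W v)
    nlinarith [mul_nonneg this hP0]
  · have : jm W u v - pm W u * pm W v = 0 := by
      rcases hP0.eq_or_lt with h1 | h1
      · rw [← h1] at hJ1 ⊢; linarith
      · have h2 : 1 - pm W u = 0 := le_antisymm (not_lt.mp fun h' => h ⟨h1, h'⟩) hQ0
        have : pm W u = 1 := by linarith
        rw [this]; linarith
    rw [this, abs_zero]
    positivity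

lemma jm_comm (W : Conf V → ℝ) (u v : V) : jm W u v = jm W v u := by
  simp only [jm, and_comm]

lemma jm_self (W : Conf V → ℝ) (u : V) : jm W u u = pm W u := by
  simp only [jm, pm, and_self]

lemma var_bound (W : Conf V → ℝ) (hW : IsDist W) (η : ℝ) (h : SIinf W η) : Quad (1 + η) W := by
  intro y
  rw [hW.2, one_mul, one_mul, sum_ylin, sum_ylin, sum_ylin_sq]
  set c : V → V → ℝ := fun u v => jm W u v - pm W u * pm W v with hc
  have hsymm : ∀ u v, c u v = c v u := fun u v => by
    simp only [hc]; rw [jm_comm, mul_comm (pm W u)]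
  have hP0 : ∀ u, 0 ≤ pm W u := fun u => Finset.sum_nonneg fun σ _ => by
    split_ifs; exacts [hW.1 _, le_rfl]
  have hP1 : ∀ u, pm W u ≤ 1 := fun u => by
    rw [← hW.2]; exact Finset.sum_le_sum fun σ _ => by
      split_ifs; exacts [le_rfl, hW.1 _]
  have hrow : ∀ u, ∑ v, |c u v| ≤ (1 + η) * pm W u := by
    intro u
    have h1 : ∀ v, |c u v| ≤ pm W u * |infl W u v| + if u = v then pm W u else 0 := by
      intro v
      by_cases huv : u = v
      · subst huv
        simp only [hc, jm_self, if_true]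
        have := hP0 u
        have := hP1 u
        rw [abs_of_nonneg (by nlinarith)]
        have : 0 ≤ pm W u * |infl W u u| := by positivity
        nlinarith
      · simpa [huv] using cov_bound W hW u v huv
    calc ∑ v, |c u v| ≤ ∑ v, (pm W u * |infl W u v| + if u = v then pm W u else 0) :=
          Finset.sum_le_sum fun v _ => h1 v
      _ = pm W u * (∑ v, |infl W u v|) + pm W u := by
          rw [Finset.sum_add_distrib, Finset.mul_sum]; simp
      _ ≤ _ := by nlinarith [h u, hP0 u, mul_le_mul_of_nonneg_left (h u) (hP0 u)]
  have e1 : ∑ u, ∑ v, y u * y v * jm W u v - (∑ v, y v * pm W v) ^ 2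
      = ∑ u, ∑ v, y u * y v * c u v := by
    rw [sq, Finset.sum_mul_sum, ← Finset.sum_sub_distrib]
    refine Finset.sum_congr rfl fun u _ => ?_
    rw [← Finset.sum_sub_distrib]
    refine Finset.sum_congr rfl fun v _ => ?_
    simp only [hc]; ring
  rw [e1]
  have e2 : ∑ u, ∑ v, y u * y v * c u v ≤
      ∑ u, ∑ v, ((1/2) * (y u ^ 2 * |c u v|) + (1/2) * (y v ^ 2 * |c v u|)) := by
    refine Finset.sum_le_sum fun u _ => Finset.sum_le_sum fun v _ => ?_
    rw [hsymm v u]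
    have h1 : y u * y v * c u v ≤ |y u * y v| * |c u v| := by
      rw [← abs_mul]; exact le_abs_self _
    have h2 : |y u * y v| ≤ (1/2) * (y u ^2 + y v ^ 2) := by
      rw [abs_le]; constructor <;> nlinarith [sq_nonneg (y u + y v), sq_nonneg (y u - y v)]
    nlinarith [mul_le_mul_of_nonneg_right h2 (abs_nonneg (c u v))]
  refine e2.trans ?_
  have e3 : ∑ u, ∑ v, ((1/2) * (y u ^ 2 * |c u v|) + (1/2) * (y v ^ 2 * |c v u|))
      = ∑ u, y u ^ 2 * ∑ v, |c u v| := by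
    simp only [Finset.sum_add_distrib]
    rw [Finset.sum_comm (f := fun u v => (1/2) * (y v ^ 2 * |c v u|)), ← Finset.sum_add_distrib]
    refine Finset.sum_congr rfl fun u _ => ?_
    rw [← Finset.sum_add_distrib, Finset.mul_sum]
    refine Finset.sum_congr rfl fun v _ => ?_
    ring
  rw [e3, Finset.mul_sum]
  refine Finset.sum_le_sum fun u _ => ?_
  nlinarith [mul_le_mul_of_nonneg_left (hrow u) (sq_nonneg (y u))]

lemma Quad.smul {k : ℝ} {W : Conf V → ℝ} (h : Quad k W) (c : ℝ) : Quad k (fun σ => c * W σ) := by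
  intro y
  have := mul_le_mul_of_nonneg_left (h y) (sq_nonneg c)
  simp only [mul_assoc, ← Finset.mul_sum] at this ⊢
  nlinarith [this]

def pw (α β : V → ℝ) (σ : Conf V) : ℝ := ∏ v, if σ v = true then α v else β v

lemma quad_pos (μ : Conf V → ℝ) (hμ : IsDist μ) (η : ℝ) (hSI : SIinfAllFields μ η)
    (α β : V → ℝ) (hα : ∀ v, 0 < α v) (hβ : ∀ v, 0 < β v) :
    Quad (1 + η) (fun σ => μ σ * pw α β σ) := by
  set lam : V → ℝ := fun v => α v / β v with hl
  have hlp : ∀ v, 0 < lam v := fun v => div_pos (hα v) (hβ v)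
  set Z := ∑ τ : Conf V, μ τ * ∏ v : V, if τ v then lam v else 1 with hZ
  have hpp : ∀ τ : Conf V, 0 < ∏ v : V, if τ v then lam v else 1 := fun τ =>
    Finset.prod_pos fun v _ => by split_ifs; exacts [hlp v, one_pos]
  have hZp : 0 < Z := by
    have : ∃ τ, 0 < μ τ := by
      by_contra hcon
      push Not at hcon
      have : ∑ a, μ a ≤ 0 := Finset.sum_nonpos fun a _ => hcon a
      linarith [hμ.2]
    obtain ⟨τ, hτ⟩ := this
    exact Finset.sum_pos' (fun τ _ => mul_nonneg (hμ.1 τ) (hpp τ).le)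
      ⟨τ, Finset.mem_univ _, mul_pos hτ (hpp τ)⟩
  have hd : IsDist (magnetize μ lam) := by
    refine ⟨fun σ => div_nonneg (mul_nonneg (hμ.1 σ) (hpp σ).le) hZp.le, ?_⟩
    simp only [magnetize, ← Finset.sum_div]
    exact div_self hZp.ne'
  have := (var_bound _ hd η (hSI lam hlp)).smul (Z * ∏ v, β v)
  convert this using 2 with σ
  simp only [magnetize]
  rw [← hZ]
  have : pw α β σ = (∏ v, β v) * ∏ v : V, if σ v then lam v else 1 := by
    rw [pw, ← Finset.prod_mul_distrib]
    refine Finset.prod_congr rfl fun v _ => ?_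
    have := (hβ v).ne'
    split_ifs
    · simp only [hl]; field_simp
    · simp
  rw [this]
  field_simp

lemma quad_nonneg (μ : Conf V → ℝ) (hμ : IsDist μ) (η : ℝ) (hSI : SIinfAllFields μ η)
    (α β : V → ℝ) (hα : ∀ v, 0 < α v) (hβ : ∀ v, 0 ≤ β v) :
    Quad (1 + η) (fun σ => μ σ * pw α β σ) := by
  intro y
  have hc : ∀ σ, Continuous fun ε : ℝ => pw α (fun v => β v + ε) σ := by
    intro σ
    unfold pw
    refine continuous_finset_prod _ fun v _ => ?_
    split_ifs <;> fun_prop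
  have key : ∀ ε : ℝ, 0 < ε → _ := fun ε hε =>
    quad_pos μ hμ η hSI α (fun v => β v + ε) hα (fun v => add_pos_of_nonneg_of_pos (hβ v) hε) y
  have h0 : (fun σ => μ σ * pw α β σ) = fun σ => μ σ * pw α (fun v => β v + 0) σ := by simp
  rw [h0]
  refine le_of_tendsto_of_tendsto (b := nhdsWithin (0:ℝ) (Set.Ioi 0))
    (f := fun ε : ℝ => (∑ σ, μ σ * pw α (fun v => β v + ε) σ) * (∑ σ, μ σ * pw α (fun v => β v + ε) σ * (ylin y σ) ^ 2) - (∑ σ, μ σ * pw α (fun v => β v + ε) σ * ylin y σ) ^ 2)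
    (g := fun ε : ℝ => (1 + η) * ((∑ σ, μ σ * pw α (fun v => β v + ε) σ) * ∑ σ, μ σ * pw α (fun v => β v + ε) σ * ylin (fun v => y v ^ 2) σ)) ?_ ?_ ?_
  · exact (Continuous.tendsto (by fun_prop) 0).mono_left nhdsWithin_le_nhds
  · exact (Continuous.tendsto (by fun_prop) 0).mono_left nhdsWithin_le_nhds
  · filter_upwards [self_mem_nhdsWithin] with ε hε
    exact key ε hε

lemma hasDerivAt_ylin (y y' : V → ℝ → ℝ) (t : ℝ) (σ : Conf V)
    (h : ∀ v, HasDerivAt (y v) (y' v t) t) :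
    HasDerivAt (fun t => ylin (fun v => y v t) σ) (ylin (fun v => y' v t) σ) t := by
  unfold ylin
  refine HasDerivAt.fun_sum fun v _ => ?_
  split_ifs
  · exact h v
  · exact hasDerivAt_const _ _

lemma log_pw (α : V → ℝ) (hα : ∀ v, 0 < α v) (σ : Conf V) :
    Real.log (pw α 1 σ) = ylin (fun v => Real.log (α v)) σ := by
  unfold pw ylin
  rw [Real.log_prod]
  · refine Finset.sum_congr rfl fun v _ => ?_
    split_ifs <;> simp
  · intro v _
    split_ifs
    · exact (hα v).ne'
    · simp

lemma pw_pos (α : V → ℝ) (hα : ∀ v, 0 < α v) (σ : Conf V) : 0 < pw α 1 σ :=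
  Finset.prod_pos fun v _ => by split_ifs; exacts [hα v, by simp]

lemma ylin_mul (a : ℝ) (y : V → ℝ) (σ : Conf V) :
    ylin (fun v => a * y v) σ = a * ylin y σ := by
  simp only [ylin, Finset.mul_sum]
  refine Finset.sum_congr rfl fun v _ => ?_
  split_ifs <;> simp

lemma exp_ylin (k : ℝ) (x : V → ℝ) (hx : ∀ v, 0 < x v) (σ : Conf V) :
    Real.exp ((1/k) * ylin (fun v => Real.log (x v)) σ) = pw (fun v => x v ^ (1/k)) 1 σ := by
  have hp : ∀ v, 0 < x v ^ (1/k) := fun v => Real.rpow_pos_of_pos (hx v) _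
  rw [← Real.exp_log (pw_pos _ hp σ), log_pw _ hp, ← ylin_mul]
  congr 2
  ext v
  rw [Real.log_rpow (hx v)]

lemma tangent_bound (W : Conf V → ℝ) (hW : ∀ σ, 0 ≤ W σ) (hB : 0 < ∑ σ, W σ) (k : ℝ) (hk : 0 < k)
    (hQ : ∀ lam : V → ℝ, (∀ v, 0 < lam v) → Quad k (fun σ => W σ * pw lam 1 σ))
    (z : V → ℝ) (hz : ∀ v, 0 < z v) :
    Real.log (∑ σ, W σ * pw (fun v => z v ^ (1/k)) 1 σ) ≤
      Real.log (∑ σ, W σ) + (1/k) * ∑ v, (z v - 1) * (pm W v / ∑ σ, W σ) := by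
  set x : V → ℝ → ℝ := fun v t => 1 + t * (z v - 1) with hx
  have hxp : ∀ t ∈ Set.Icc (0:ℝ) 1, ∀ v, 0 < x v t := by
    intro t ht v
    simp only [hx]
    rcases ht.1.eq_or_lt with h | h
    · rw [← h]; simp
    · nlinarith [mul_pos h (hz v), ht.2]
  set s : Conf V → ℝ → ℝ := fun σ t => (1/k) * ylin (fun v => Real.log (x v t)) σ with hs
  set Y : Conf V → ℝ → ℝ := fun σ t => ylin (fun v => (z v - 1) / x v t) σ with hY
  set Y2 : Conf V → ℝ → ℝ := fun σ t => ylin (fun v => ((z v - 1) / x v t) ^ 2) σ with hY2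
  have dx : ∀ v t, HasDerivAt (x v) (z v - 1) t := by
    intro v t
    have := ((hasDerivAt_id t).mul_const (z v - 1)).const_add 1
    simpa [hx] using this
  have ds : ∀ t ∈ Set.Icc (0:ℝ) 1, ∀ σ, HasDerivAt (s σ) ((1/k) * Y σ t) t := by
    intro t ht σ
    exact (hasDerivAt_ylin (fun v t => Real.log (x v t)) (fun v t => (z v - 1) / x v t) t σ
      fun v => (dx v t).log (hxp t ht v).ne').const_mul (1/k)
  have dY : ∀ t ∈ Set.Icc (0:ℝ) 1, ∀ σ, HasDerivAt (Y σ) (-1 * Y2 σ t) t := by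
    intro t ht σ
    have := hasDerivAt_ylin (fun v t => (z v - 1) / x v t)
      (fun v t => -1 * ((z v - 1) / x v t) ^ 2) t σ ?_
    · simp only [ylin_mul] at this
      exact this
    · intro v
      have h := (hasDerivAt_const t (z v - 1)).div (dx v t) (hxp t ht v).ne'
      refine h.congr_deriv ?_
      rw [div_pow]
      ring
  set g : ℝ → ℝ := fun t => ∑ σ, W σ * Real.exp (s σ t) with hg
  set g1 : ℝ → ℝ := fun t => ∑ σ, W σ * Real.exp (s σ t) * Y σ t with hg1
  have hgp : ∀ t, 0 < g t := by
    intro t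
    obtain ⟨σ, -, hσ⟩ := Finset.exists_lt_of_sum_lt (s := Finset.univ) (f := fun _ => (0:ℝ))
      (g := W) (by simpa using hB)
    exact Finset.sum_pos' (fun τ _ => mul_nonneg (hW τ) (Real.exp_pos _).le)
      ⟨σ, Finset.mem_univ _, mul_pos hσ (Real.exp_pos _)⟩
  have dg : ∀ t ∈ Set.Icc (0:ℝ) 1, HasDerivAt g ((1/k) * g1 t) t := by
    intro t ht
    have : HasDerivAt g (∑ σ, W σ * (Real.exp (s σ t) * ((1/k) * Y σ t))) t :=
      HasDerivAt.fun_sum fun σ _ => ((ds t ht σ).exp).const_mul (W σ)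
    convert this using 1
    simp only [hg1, Finset.mul_sum]
    exact Finset.sum_congr rfl fun σ _ => by ring
  have dg1 : ∀ t ∈ Set.Icc (0:ℝ) 1, HasDerivAt g1
      ((1/k) * (∑ σ, W σ * Real.exp (s σ t) * Y σ t ^ 2)
        - ∑ σ, W σ * Real.exp (s σ t) * Y2 σ t) t := by
    intro t ht
    have : HasDerivAt g1 (∑ σ, (W σ * (Real.exp (s σ t) * ((1/k) * Y σ t)) * Y σ t
        + W σ * Real.exp (s σ t) * (-1 * Y2 σ t))) t :=
      HasDerivAt.fun_sum fun σ _ => (((ds t ht σ).exp).const_mul (W σ)).mul (dY t ht σ)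
    convert this using 1
    rw [Finset.mul_sum, ← Finset.sum_sub_distrib]
    exact Finset.sum_congr rfl fun σ _ => by ring
  have dh : ∀ t ∈ Set.Icc (0:ℝ) 1, HasDerivAt (fun t => Real.log (g t)) ((1/k) * g1 t / g t) t :=
    fun t ht => (dg t ht).log (hgp t).ne'
  have hanti : AntitoneOn (fun t => (1/k) * g1 t / g t) (Set.Icc 0 1) := by
    have dd : ∀ t ∈ Set.Icc (0:ℝ) 1, HasDerivAt (fun t => (1/k) * g1 t / g t) _ t :=
      fun t ht => ((dg1 t ht).const_mul (1/k)).div (dg t ht) (hgp t).ne'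
    refine antitoneOn_of_deriv_nonpos (convex_Icc 0 1)
      (fun t ht => (dd t ht).continuousAt.continuousWithinAt)
      (fun t ht => (dd t (interior_subset ht)).differentiableAt.differentiableWithinAt) ?_
    intro t ht
    have ht := interior_subset ht
    rw [(dd t ht).deriv]
    refine div_nonpos_of_nonpos_of_nonneg ?_ (sq_nonneg _)
    have hq := hQ (fun v => x v t ^ (1/k)) (fun v => Real.rpow_pos_of_pos (hxp t ht v) _)
      (fun v => (z v - 1) / x v t)
    simp only [← exp_ylin k (fun v => x v t) (hxp t ht)] at hq
    change g t * (∑ σ, W σ * Real.exp (s σ t) * Y σ t ^ 2) - g1 t ^ 2 ≤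
      k * (g t * ∑ σ, W σ * Real.exp (s σ t) * Y2 σ t) at hq
    generalize (∑ σ, W σ * Real.exp (s σ t) * Y σ t ^ 2) = a at *
    generalize (∑ σ, W σ * Real.exp (s σ t) * Y2 σ t) = b at *
    have e : 1 / k * (1 / k * a - b) * g t - 1 / k * g1 t * (1 / k * g1 t)
        = (1/k)^2 * ((g t * a - g1 t ^ 2) - k * (g t * b)) := by
      field_simp
      ring
    rw [e]
    exact mul_nonpos_of_nonneg_of_nonpos (sq_nonneg _) (by linarith)
  have hmv := exists_hasDerivAt_eq_slope (fun t => Real.log (g t)) (fun t => (1/k) * g1 t / g t)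
    one_pos (fun t ht => (dh t ht).continuousAt.continuousWithinAt)
    (fun t ht => dh t (Set.Ioo_subset_Icc_self ht))
  obtain ⟨c, hc, hc'⟩ := hmv
  have hle := hanti (Set.left_mem_Icc.2 zero_le_one) (Set.Ioo_subset_Icc_self hc) hc.1.le
  simp only at hle
  rw [hc'] at hle
  have hx0 : ∀ v, x v 0 = 1 := fun v => by simp [hx]
  have hx1 : ∀ v, x v 1 = z v := fun v => by simp [hx]
  have hs0 : ∀ σ, s σ 0 = 0 := fun σ => by simp [hs, hx0, ylin]
  have hg0 : g 0 = ∑ σ, W σ := by simp [hg, hs0]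
  have hg10 : g1 0 = ∑ v, (z v - 1) * pm W v := by
    simp only [hg1, hs0, hY, hx0, Real.exp_zero, mul_one, div_one]
    exact sum_ylin W _
  have hgg : g 1 = ∑ σ, W σ * pw (fun v => z v ^ (1/k)) 1 σ := by
    simp only [hg, hs, hx1]
    exact Finset.sum_congr rfl fun σ _ => by rw [exp_ylin k z hz]
  rw [hg0, hg10, hgg] at hle
  have e : ∑ v, (z v - 1) * (pm W v / ∑ σ, W σ) = (∑ v, (z v - 1) * pm W v) / ∑ σ, W σ := by
    rw [Finset.sum_div]; exact Finset.sum_congr rfl fun v _ => by ring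
  rw [e]
  have : 1 / k * (∑ v, (z v - 1) * pm W v) / ∑ σ, W σ
    = 1 / k * ((∑ v, (z v - 1) * pm W v) / ∑ σ, W σ) := by ring
  rw [this] at hle
  simp only [sub_zero, div_one] at hle
  linarith

lemma mul_log_bound (a b : ℝ) (ha : 0 < a) (hb : 0 < b) :
    a - b ≤ a * (Real.log a - Real.log b) := by
  have := Real.log_le_sub_one_of_pos (div_pos hb ha)
  rw [Real.log_div hb.ne' ha.ne'] at this
  have h2 := mul_le_mul_of_nonneg_left this ha.le
  have : a * (b / a - 1) = b - a := by field_simp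
  rw [this] at h2
  linarith

lemma sum_lt_of (W f : Conf V → ℝ) (hW : ∀ σ, 0 ≤ W σ) (hf : ∀ σ, 0 < f σ)
    (hB : 0 < ∑ σ, W σ) : 0 < ∑ σ, W σ * f σ := by
  obtain ⟨σ, -, hσ⟩ := Finset.exists_lt_of_sum_lt (s := Finset.univ) (f := fun _ => (0:ℝ))
      (g := W) (by simpa using hB)
  exact Finset.sum_pos' (fun τ _ => mul_nonneg (hW τ) (hf _).le)
      ⟨σ, Finset.mem_univ _, mul_pos hσ (hf _)⟩

lemma dv (W f h : Conf V → ℝ) (hW : ∀ σ, 0 ≤ W σ) (hf : ∀ σ, 0 < f σ) (hh : ∀ σ, 0 < h σ)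
    (hB : 0 < ∑ σ, W σ) :
    (∑ σ, W σ * f σ * Real.log (h σ)) + (∑ σ, W σ * f σ) *
      (Real.log (∑ σ, W σ * f σ) - Real.log (∑ σ, W σ * h σ)) ≤
      ∑ σ, W σ * (f σ * Real.log (f σ)) := by
  have hA := sum_lt_of W f hW hf hB
  have hG := sum_lt_of W h hW hh hB
  set A := ∑ σ, W σ * f σ with hAd
  set G := ∑ σ, W σ * h σ with hGd
  have key : ∀ σ, W σ * (f σ - h σ * (A / G)) ≤ W σ * (f σ * Real.log (f σ))
      - W σ * f σ * Real.log (h σ) - W σ * f σ * (Real.log A - Real.log G) := by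
    intro σ
    have := mul_le_mul_of_nonneg_left (mul_log_bound (f σ) (h σ * (A / G)) (hf σ)
      (mul_pos (hh σ) (div_pos hA hG))) (hW σ)
    rw [Real.log_mul (hh σ).ne' (div_pos hA hG).ne', Real.log_div hA.ne' hG.ne'] at this
    linarith
  have h1 := Finset.sum_le_sum fun σ (_ : σ ∈ Finset.univ) => key σ
  have e : ∑ σ, W σ * (f σ - h σ * (A / G)) = 0 := by
    have : ∀ σ, W σ * (f σ - h σ * (A / G)) = W σ * f σ - W σ * h σ * (A / G) := fun σ => by ring
    simp only [this, Finset.sum_sub_distrib, ← Finset.sum_mul]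
    rw [← hAd, ← hGd, mul_div_cancel₀ _ hG.ne', sub_self]
  rw [e, Finset.sum_sub_distrib, Finset.sum_sub_distrib, ← Finset.sum_mul, ← hAd] at h1
  linarith

lemma ent_ind (W f : Conf V → ℝ) (hW : ∀ σ, 0 ≤ W σ) (hf : ∀ σ, 0 < f σ)
    (hB : 0 < ∑ σ, W σ) (k : ℝ) (hk : 0 < k)
    (hQ : ∀ lam : V → ℝ, (∀ v, 0 < lam v) → Quad k (fun σ => W σ * pw lam 1 σ)) :
    let A := ∑ σ, W σ * f σ
    let B := ∑ σ, W σ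
    let Av := fun v => pm (fun σ => W σ * f σ) v
    let Bv := fun v => pm W v
    ∑ v, (Av v * (Real.log (Av v / Bv v) - Real.log (A / B)) - Av v + A * Bv v / B) ≤
      k * (∑ σ, W σ * (f σ * Real.log (f σ)) - A * Real.log (A / B)) := by
  intro A B Av Bv
  have hA : 0 < A := sum_lt_of W f hW hf hB
  have hAB : ∀ v, 0 ≤ Bv v ∧ (0 < Bv v → 0 < Av v) ∧ (Bv v = 0 → Av v = 0) := by
    intro v
    have h0 : ∀ σ : Conf V, 0 ≤ if σ v = true then W σ else 0 := fun σ => by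
      split_ifs; exacts [hW _, le_rfl]
    have e : Av v = ∑ σ : Conf V, (if σ v = true then W σ else 0) * f σ :=
      Finset.sum_congr rfl fun σ _ => by simp only [ite_mul, zero_mul]
    refine ⟨Finset.sum_nonneg fun σ _ => h0 σ, fun h => ?_, fun h => ?_⟩
    · rw [e]; exact sum_lt_of _ f h0 hf h
    · rw [e]
      have := (Finset.sum_eq_zero_iff_of_nonneg fun σ _ => h0 σ).1 h
      exact Finset.sum_eq_zero fun σ hσ => by rw [this σ hσ, zero_mul]
  set z : V → ℝ := fun v => if Bv v = 0 then 1 else (Av v / Bv v) / (A / B) with hz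
  have hzp : ∀ v, 0 < z v := by
    intro v
    simp only [hz]
    split_ifs with h
    · exact one_pos
    · have h1 : 0 < Bv v := lt_of_le_of_ne (hAB v).1 (Ne.symm h)
      exact div_pos (div_pos ((hAB v).2.1 h1) h1) (div_pos hA hB)
  have hzk : ∀ v, 0 < z v ^ (1/k) := fun v => Real.rpow_pos_of_pos (hzp v) _
  have h1 := tangent_bound W hW hB k hk hQ z hzp
  have h2 := dv W f (pw (fun v => z v ^ (1/k)) 1) hW hf (fun σ => pw_pos _ hzk σ) hB
  have e1 : ∑ σ, W σ * f σ * Real.log (pw (fun v => z v ^ (1/k)) 1 σ)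
      = (1/k) * ∑ v, Av v * Real.log (z v) := by
    simp only [log_pw _ hzk]
    rw [sum_ylin (fun σ => W σ * f σ), Finset.mul_sum]
    refine Finset.sum_congr rfl fun v _ => ?_
    rw [Real.log_rpow (hzp v)]; ring
  rw [e1] at h2
  have h3 := mul_le_mul_of_nonneg_left h1 hA.le
  have e2 : ∑ v, (Av v * (Real.log (Av v / Bv v) - Real.log (A / B)) - Av v + A * Bv v / B)
      = ∑ v, Av v * Real.log (z v) - A * ∑ v, (z v - 1) * (pm W v / B) := by
    rw [Finset.mul_sum, ← Finset.sum_sub_distrib]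
    refine Finset.sum_congr rfl fun v _ => ?_
    by_cases h : Bv v = 0
    · have h' : pm W v = 0 := h
      rw [(hAB v).2.2 h, h, h']; simp
    · have hb : 0 < Bv v := lt_of_le_of_ne (hAB v).1 (Ne.symm h)
      have ha := (hAB v).2.1 hb
      have : z v = (Av v / Bv v) / (A / B) := by simp only [hz, if_neg h]
      rw [this, Real.log_div (div_pos ha hb).ne' (div_pos hA hB).ne']
      change _ = _ - A * ((Av v / Bv v / (A / B) - 1) * (Bv v / B))
      have hB' : B ≠ 0 := hB.ne'
      have := hA.ne'
      field_simp
      ring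
  rw [e2, Real.log_div hA.ne' hB.ne']
  change (1/k) * ∑ v, Av v * Real.log (z v) + A * (Real.log A - _) ≤ _ at h2
  change _ ≤ A * (Real.log B + _ ) at h3
  have h4 : (1/k) * ((∑ v, Av v * Real.log (z v)) - A * ∑ v, (z v - 1) * (pm W v / B)) ≤
    ∑ σ, W σ * (f σ * Real.log (f σ)) - A * (Real.log A - Real.log B) := by
    change A * _ ≤ A * (Real.log B + 1 / k * ∑ v, (z v - 1) * (pm W v / B)) at h3
    linarith
  have h5 := mul_le_mul_of_nonneg_left h4 hk.le
  rwa [← mul_assoc, mul_one_div_cancel hk.ne', one_mul] at h5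

def bw (R : Finset V) (t : ℝ) (σ : Conf V) : ℝ :=
  if R ⊆ plusSet σ then t ^ (plusSet σ \ R).card else 0

def mR (g : Conf V → ℝ) (R : Finset V) (t : ℝ) : ℝ := ∑ σ, g σ * bw R t σ

lemma mem_plusSet (σ : Conf V) (v : V) : v ∈ plusSet σ ↔ σ v = true := by
  simp [plusSet]

lemma bw_eq (R : Finset V) (t : ℝ) (σ : Conf V) :
    bw R t σ = pw (fun v => if v ∈ R then 1 else t) (fun v => if v ∈ R then 0 else 1) σ := by
  unfold bw pw
  split_ifs with h
  · have : ∀ v, (if σ v = true then (if v ∈ R then 1 else t) else if v ∈ R then 0 else 1)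
        = if v ∈ plusSet σ \ R then t else 1 := by
      intro v
      have := @h v
      simp only [Finset.mem_sdiff, mem_plusSet] at this ⊢
      by_cases h1 : σ v = true <;> by_cases h2 : v ∈ R <;> simp_all
    simp only [this]
    rw [Finset.prod_ite_mem]
    simp
  · obtain ⟨v, hv, hv'⟩ := Finset.not_subset.1 h
    rw [mem_plusSet] at hv'
    exact (Finset.prod_eq_zero (Finset.mem_univ v) (by simp [hv, hv'])).symm

lemma bw_nonneg (R : Finset V) (t : ℝ) (ht : 0 ≤ t) (σ : Conf V) : 0 ≤ bw R t σ := by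
  unfold bw; split_ifs <;> positivity

lemma quad_bw (μ : Conf V → ℝ) (hμ : IsDist μ) (η : ℝ) (hSI : SIinfAllFields μ η)
    (R : Finset V) (t : ℝ) (ht : 0 < t) (lam : V → ℝ) (hl : ∀ v, 0 < lam v) :
    Quad (1 + η) (fun σ => (μ σ * bw R t σ) * pw lam 1 σ) := by
  have := quad_nonneg μ hμ η hSI (fun v => (if v ∈ R then 1 else t) * lam v)
    (fun v => if v ∈ R then 0 else 1)
    (fun v => mul_pos (by split_ifs; exacts [one_pos, ht]) (hl v))
    (fun v => by split_ifs <;> norm_num)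
  convert this using 2 with σ
  rw [bw_eq, mul_assoc]
  congr 1
  unfold pw
  rw [← Finset.prod_mul_distrib]
  refine Finset.prod_congr rfl fun v _ => ?_
  split_ifs <;> simp

lemma bw_insert (R : Finset V) (t : ℝ) (σ : Conf V) (v : V) (hv : v ∉ R) :
    t * bw (insert v R) t σ = if σ v = true then bw R t σ else 0 := by
  unfold bw
  by_cases h : R ⊆ plusSet σ
  · by_cases h2 : σ v = true
    · have h3 : insert v R ⊆ plusSet σ :=
        Finset.insert_subset ((mem_plusSet _ _).2 h2) h
      have h4 : v ∈ plusSet σ \ R := Finset.mem_sdiff.2 ⟨(mem_plusSet _ _).2 h2, hv⟩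
      rw [if_pos h3, if_pos h2, if_pos h, Finset.sdiff_insert, ← pow_succ',
        Finset.card_erase_add_one h4]
    · have h3 : ¬ insert v R ⊆ plusSet σ := fun h' =>
        h2 ((mem_plusSet _ _).1 (h' (Finset.mem_insert_self _ _)))
      rw [if_neg h3, if_neg h2, mul_zero]
  · have h3 : ¬ insert v R ⊆ plusSet σ := fun h' =>
        h ((Finset.subset_insert _ _).trans h')
    rw [if_neg h3, if_neg h]; simp

lemma pm_bw (g : Conf V → ℝ) (R : Finset V) (t : ℝ) (v : V) (hv : v ∉ R) :
    pm (fun σ => g σ * bw R t σ) v = t * mR g (insert v R) t := by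
  unfold pm mR
  rw [Finset.mul_sum]
  refine Finset.sum_congr rfl fun σ _ => ?_
  have := bw_insert R t σ v hv
  split_ifs at this ⊢ <;> rw [← mul_assoc, mul_comm t, mul_assoc, this]
  simp

lemma pm_bw_mem (g : Conf V → ℝ) (R : Finset V) (t : ℝ) (v : V) (hv : v ∈ R) :
    pm (fun σ => g σ * bw R t σ) v = mR g R t := by
  unfold pm mR
  refine Finset.sum_congr rfl fun σ _ => ?_
  split_ifs with h
  · rfl
  · have : ¬ R ⊆ plusSet σ := fun h' => h ((mem_plusSet _ _).1 (h' hv))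
    simp [bw, this]

lemma hasDerivAt_bw (R : Finset V) (t : ℝ) (σ : Conf V) :
    HasDerivAt (fun t => bw R t σ) (∑ v ∈ Rᶜ, bw (insert v R) t σ) t := by
  by_cases h : R ⊆ plusSet σ
  · have e : (fun t => bw R t σ) = fun t => t ^ (plusSet σ \ R).card := by
      ext t; simp [bw, h]
    rw [e]
    refine (hasDerivAt_pow (plusSet σ \ R).card t).congr_deriv ?_
    symm
    have : ∀ v ∈ Rᶜ, bw (insert v R) t σ =
        if v ∈ plusSet σ then t ^ ((plusSet σ \ R).card - 1) else 0 := by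
      intro v hv
      rw [Finset.mem_compl] at hv
      unfold bw
      by_cases h2 : v ∈ plusSet σ
      · have h4 : v ∈ plusSet σ \ R := Finset.mem_sdiff.2 ⟨h2, hv⟩
        rw [if_pos (Finset.insert_subset h2 h), if_pos h2, Finset.sdiff_insert,
          Finset.card_erase_of_mem h4]
      · rw [if_neg h2, if_neg fun h' => h2 (h' (Finset.mem_insert_self _ _))]
    rw [Finset.sum_congr rfl this, Finset.sum_ite_mem, Finset.sum_const, nsmul_eq_mul]
    have : Rᶜ ∩ plusSet σ = plusSet σ \ R := by
      ext v; simp [and_comm]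
    rw [this]
  · have h3 : ∀ v, ¬ insert v R ⊆ plusSet σ := fun v h' =>
        h ((Finset.subset_insert _ _).trans h')
    simp only [bw, h, h3, if_false, Finset.sum_const_zero]
    exact hasDerivAt_const _ _

lemma hasDerivAt_mR (g : Conf V → ℝ) (R : Finset V) (t : ℝ) :
    HasDerivAt (mR g R) (∑ v ∈ Rᶜ, mR g (insert v R) t) t := by
  have : HasDerivAt (mR g R) (∑ σ, g σ * ∑ v ∈ Rᶜ, bw (insert v R) t σ) t :=
    HasDerivAt.fun_sum fun σ _ => (hasDerivAt_bw R t σ).const_mul (g σ)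
  convert this using 1
  simp only [mR, Finset.mul_sum]
  rw [Finset.sum_comm]

lemma mR_zero (μ f : Conf V → ℝ) (hμ : ∀ σ, 0 ≤ μ σ) (R R' : Finset V) (hR : R ⊆ R') (t : ℝ)
    (ht : 0 < t) (h : mR μ R t = 0) (s : ℝ) : mR (fun σ => μ σ * f σ) R' s = 0 := by
  have h1 := (Finset.sum_eq_zero_iff_of_nonneg
    fun σ _ => mul_nonneg (hμ σ) (bw_nonneg R t ht.le σ)).1 h
  refine Finset.sum_eq_zero fun σ hσ => ?_
  have h2 := h1 σ hσ
  by_cases h3 : R' ⊆ plusSet σ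
  · have h4 : bw R t σ ≠ 0 := by
      rw [bw, if_pos (hR.trans h3)]; positivity
    rcases mul_eq_zero.1 h2 with h5 | h5
    · simp [h5]
    · exact absurd h5 h4
  · simp [bw, h3]

def psi (μ f : Conf V → ℝ) (R : Finset V) (t : ℝ) : ℝ :=
  mR (fun σ => μ σ * f σ) R t * Real.log (mR (fun σ => μ σ * f σ) R t / mR μ R t)

lemma mR_pos_of (μ f : Conf V → ℝ) (hμ : ∀ σ, 0 ≤ μ σ) (hf : ∀ σ, 0 < f σ) (R : Finset V) (t : ℝ)
    (ht : 0 < t) (h : 0 < mR μ R t) : 0 < mR (fun σ => μ σ * f σ) R t := by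
  have := sum_lt_of (fun σ => μ σ * bw R t σ) f
    (fun σ => mul_nonneg (hμ σ) (bw_nonneg R t ht.le σ)) hf h
  convert this using 1
  exact Finset.sum_congr rfl fun σ _ => by ring

lemma mR_nonneg (μ : Conf V → ℝ) (hμ : ∀ σ, 0 ≤ μ σ) (R : Finset V) (t : ℝ)
    (ht : 0 < t) : 0 ≤ mR μ R t :=
  Finset.sum_nonneg fun σ _ => mul_nonneg (hμ σ) (bw_nonneg R t ht.le σ)

lemma hasDerivAt_psi (μ f : Conf V → ℝ) (hμ : ∀ σ, 0 ≤ μ σ) (hf : ∀ σ, 0 < f σ) (R : Finset V)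
    (t : ℝ) (ht : 0 < t) :
    HasDerivAt (psi μ f R) (∑ v ∈ Rᶜ, (mR (fun σ => μ σ * f σ) (insert v R) t *
        Real.log (mR (fun σ => μ σ * f σ) R t / mR μ R t) + mR (fun σ => μ σ * f σ) (insert v R) t
        - mR (fun σ => μ σ * f σ) R t * mR μ (insert v R) t / mR μ R t)) t := by
  rcases (mR_nonneg μ hμ R t ht).eq_or_lt with hb | hb
  · have h1 := fun R' hR s => mR_zero μ f hμ R R' hR t ht hb.symm s
    have e : psi μ f R = fun _ => 0 := by
      ext s; rw [psi, h1 R subset_rfl s, zero_mul]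
    rw [e]
    refine (hasDerivAt_const t (0:ℝ)).congr_deriv ?_
    symm
    refine Finset.sum_eq_zero fun v _ => ?_
    rw [h1 _ (Finset.subset_insert v R) t, h1 R subset_rfl t]
    simp
  · have ha := mR_pos_of μ f hμ hf R t ht hb
    have da := hasDerivAt_mR (fun σ => μ σ * f σ) R t
    have db := hasDerivAt_mR μ R t
    have := da.mul ((da.div db hb.ne').log (div_pos ha hb).ne')
    refine this.congr_deriv ?_
    symm
    simp only [Finset.sum_sub_distrib, Finset.sum_add_distrib, ← Finset.sum_mul,
      ← Finset.mul_sum, ← Finset.sum_div, Pi.div_apply]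
    generalize (∑ v ∈ Rᶜ, mR (fun σ => μ σ * f σ) (insert v R) t) = a'
    generalize (∑ v ∈ Rᶜ, mR μ (insert v R) t) = b'
    have := ha.ne'
    have := hb.ne'
    field_simp
    ring

lemma reindex (c : ℕ → ℝ) (φ : Finset V → ℝ) :
    ∑ R : Finset V, (R.card : ℝ) * c (R.card - 1) * φ R =
      ∑ R : Finset V, ∑ v ∈ Rᶜ, c R.card * φ (insert v R) := by
  have e1 : ∀ R : Finset V, (R.card : ℝ) * c (R.card - 1) * φ R =
      ∑ v, if v ∈ R then c (R.card - 1) * φ R else 0 := by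
    intro R
    rw [Finset.sum_ite_mem, Finset.univ_inter, Finset.sum_const, nsmul_eq_mul, mul_assoc]
  have e2 : ∀ R : Finset V, ∑ v ∈ Rᶜ, c R.card * φ (insert v R) =
      ∑ v, if v ∉ R then c R.card * φ (insert v R) else 0 := by
    intro R
    rw [← Finset.sum_filter]
    refine Finset.sum_congr ?_ fun _ _ => rfl
    ext v; simp
  simp only [e1, e2]
  rw [Finset.sum_comm]
  conv_rhs => rw [Finset.sum_comm]
  refine Finset.sum_congr rfl fun v _ => ?_
  rw [← Finset.sum_filter, ← Finset.sum_filter]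
  refine Finset.sum_nbij' (fun R => R.erase v) (fun R => insert v R) ?_ ?_ ?_ ?_ ?_
  · intro R hR; simp
  · intro R hR; simp
  · intro R hR; simp at hR; exact Finset.insert_erase hR
  · intro R hR; simp at hR; exact Finset.erase_insert hR
  · intro R hR; simp at hR
    rw [Finset.insert_erase hR, Finset.card_erase_of_mem hR]

lemma sum_mR (g : Conf V → ℝ) (t : ℝ) :
    ∑ R : Finset V, (1 - t) ^ R.card * mR g R t = ∑ σ, g σ := by
  simp only [mR, Finset.mul_sum]
  rw [Finset.sum_comm]
  refine Finset.sum_congr rfl fun σ _ => ?_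
  have := Finset.sum_pow_mul_eq_add_pow (1 - t) t (plusSet σ)
  rw [sub_add_cancel, one_pow] at this
  conv_rhs => rw [← mul_one (g σ), ← this, Finset.mul_sum]
  rw [← Finset.sum_subset (Finset.subset_univ (plusSet σ).powerset)]
  · refine Finset.sum_congr rfl fun R hR => ?_
    rw [Finset.mem_powerset] at hR
    rw [bw, if_pos hR, Finset.card_sdiff_of_subset hR]
    ring
  · intro R _ hR
    rw [Finset.mem_powerset] at hR
    simp [bw, hR]

def Ffun (μ f : Conf V → ℝ) (t : ℝ) : ℝ :=
  ∑ σ, μ σ * (f σ * Real.log (f σ)) - ∑ R : Finset V, (1 - t) ^ R.card * psi μ f R t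

lemma Ffun_eq (μ f : Conf V → ℝ) (t : ℝ) : Ffun μ f t =
    ∑ R : Finset V, (1 - t) ^ R.card *
      (mR (fun σ => μ σ * (f σ * Real.log (f σ))) R t - psi μ f R t) := by
  rw [Ffun, ← sum_mR _ t, ← Finset.sum_sub_distrib]
  exact Finset.sum_congr rfl fun R _ => by ring

def dF (μ f : Conf V → ℝ) (R : Finset V) (t : ℝ) : ℝ :=
  ∑ v ∈ Rᶜ, (psi μ f (insert v R) t - mR (fun σ => μ σ * f σ) (insert v R) t *
        Real.log (mR (fun σ => μ σ * f σ) R t / mR μ R t) - mR (fun σ => μ σ * f σ) (insert v R) t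
        + mR (fun σ => μ σ * f σ) R t * mR μ (insert v R) t / mR μ R t)

lemma hasDerivAt_F (μ f : Conf V → ℝ) (hμ : ∀ σ, 0 ≤ μ σ) (hf : ∀ σ, 0 < f σ)
    (t : ℝ) (ht : 0 < t) :
    HasDerivAt (Ffun μ f) (∑ R : Finset V, (1 - t) ^ R.card * dF μ f R t) t := by
  have d1 : ∀ R : Finset V, HasDerivAt (fun t : ℝ => (1 - t) ^ R.card)
      (-((R.card : ℝ) * (1 - t) ^ (R.card - 1))) t := by
    intro R
    have := ((hasDerivAt_id t).const_sub 1).pow R.card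
    refine this.congr_deriv ?_
    simp
  have d2 := (HasDerivAt.fun_sum fun (R : Finset V) (_ : R ∈ Finset.univ) =>
    (d1 R).mul (hasDerivAt_psi μ f hμ hf R t ht)).const_sub
      (∑ σ, μ σ * (f σ * Real.log (f σ)))
  refine HasDerivAt.congr_deriv (f := Ffun μ f) d2 ?_
  rw [Finset.sum_add_distrib, neg_add]
  have e : ∀ R : Finset V, -((R.card : ℝ) * (1 - t) ^ (R.card - 1)) * psi μ f R t =
    -((R.card : ℝ) * (1 - t) ^ (R.card - 1) * psi μ f R t) := fun R => by ring
  simp only [e, Finset.sum_neg_distrib, neg_neg]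
  rw [reindex (fun n => (1 - t) ^ n) (fun R => psi μ f R t), ← sub_eq_add_neg,
    ← Finset.sum_sub_distrib]
  refine Finset.sum_congr rfl fun R _ => ?_
  rw [dF, Finset.mul_sum, Finset.mul_sum, ← Finset.sum_sub_distrib]
  exact Finset.sum_congr rfl fun v _ => by ring

lemma dF_le (μ f : Conf V → ℝ) (hμ : IsDist μ) (hf : ∀ σ, 0 < f σ) (η : ℝ) (hη : 0 < η)
    (hSI : SIinfAllFields μ η) (R : Finset V) (t : ℝ) (ht : 0 < t) :
    t * dF μ f R t ≤ (1 + η) * (mR (fun σ => μ σ * (f σ * Real.log (f σ))) R t - psi μ f R t) := by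
  rcases (mR_nonneg μ hμ.1 R t ht).eq_or_lt with hb | hb
  · have h1 := fun f R' hR s => mR_zero μ f hμ.1 R R' hR t ht hb.symm s
    have e : dF μ f R t = 0 := by
      refine Finset.sum_eq_zero fun v _ => ?_
      rw [psi, h1 f _ (Finset.subset_insert v R) t, h1 f R subset_rfl t]
      simp
    rw [e, h1 (fun σ => f σ * Real.log (f σ)) R subset_rfl t, psi, h1 f R subset_rfl t]
    simp
  · have key := ent_ind (fun σ => μ σ * bw R t σ) f
      (fun σ => mul_nonneg (hμ.1 σ) (bw_nonneg R t ht.le σ)) hf hb (1 + η) (by linarith)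
      (fun lam hl => quad_bw μ hμ η hSI R t ht lam hl)
    have e1 : ∀ g : Conf V → ℝ, (fun σ => μ σ * bw R t σ * g σ) =
        fun σ => (μ σ * g σ) * bw R t σ := fun g => by ext σ; ring
    have e3 : ∑ σ, μ σ * bw R t σ = mR μ R t := rfl
    simp only [e1, e3] at key
    have e4 : ∑ σ, μ σ * f σ * bw R t σ = mR (fun σ => μ σ * f σ) R t := rfl
    have e5 : ∑ σ, μ σ * (f σ * Real.log (f σ)) * bw R t σ =
      mR (fun σ => μ σ * (f σ * Real.log (f σ))) R t := rfl
    simp only [e4] at key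
    rw [e5] at key
    refine le_trans (le_of_eq ?_) key
    have hbne := hb.ne'
    rw [← Finset.sum_subset (Finset.subset_univ Rᶜ)]
    · rw [dF, Finset.mul_sum]
      refine Finset.sum_congr rfl fun v hv => ?_
      rw [Finset.mem_compl] at hv
      rw [pm_bw _ _ _ _ hv, pm_bw _ _ _ _ hv, psi, mul_div_mul_left _ _ ht.ne']
      ring
    · intro v _ hv
      rw [Finset.mem_compl, not_not] at hv
      rw [pm_bw_mem _ _ _ _ hv, pm_bw_mem _ _ _ _ hv]
      field_simp
      ring

lemma F_growth (μ f : Conf V → ℝ) (hμ : IsDist μ) (hf : ∀ σ, 0 < f σ) (η : ℝ) (hη : 0 < η)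
    (hSI : SIinfAllFields μ η) (θ : ℝ) (h0 : 0 < θ) (h1 : θ < 1) :
    Ffun μ f 1 ≤ θ ^ (-(1 + η)) * Ffun μ f θ := by
  have hd : ∀ t, 0 < t → HasDerivAt (fun t => t ^ (-(1 + η)) * Ffun μ f t) _ t := fun t ht =>
    (Real.hasDerivAt_rpow_const (p := -(1 + η)) (Or.inl ht.ne')).mul (hasDerivAt_F μ f hμ.1 hf t ht)
  have hp : ∀ t ∈ Set.Icc θ 1, 0 < t := fun t ht => h0.trans_le ht.1
  have := antitoneOn_of_deriv_nonpos (convex_Icc θ 1)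
    (fun t ht => (hd t (hp t ht)).continuousAt.continuousWithinAt)
    (fun t ht => (hd t (hp t (interior_subset ht))).differentiableAt.differentiableWithinAt) ?_
    (Set.left_mem_Icc.2 h1.le) (Set.right_mem_Icc.2 h1.le) h1.le
  · simpa using this
  · intro t ht
    have ht := interior_subset ht
    have htp := hp t ht
    rw [(hd t htp).deriv]
    have e : t ^ (-(1 + η)) = t ^ (-(1 + η) - 1) * t := by
      rw [Real.rpow_sub_one htp.ne']; field_simp
    rw [e]
    have hle : t * ∑ R : Finset V, (1 - t) ^ R.card * dF μ f R t ≤ (1 + η) * Ffun μ f t := by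
      rw [Ffun_eq, Finset.mul_sum, Finset.mul_sum]
      refine Finset.sum_le_sum fun R _ => ?_
      have := mul_le_mul_of_nonneg_left (dF_le μ f hμ hf η hη hSI R t htp)
        (pow_nonneg (sub_nonneg.2 ht.2) R.card)
      linarith
    have hpp : 0 < t ^ (-(1 + η) - 1) := Real.rpow_pos_of_pos htp _
    have := mul_le_mul_of_nonneg_left hle hpp.le
    linarith

lemma F_one (μ f : Conf V → ℝ) (hμ : IsDist μ) : Ffun μ f 1 = entOf μ f := by
  have hm : ∀ g : Conf V → ℝ, mR g ∅ 1 = ∑ σ, g σ := fun g => by simp [mR, bw]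
  rw [Ffun, entOf, Finset.sum_eq_single (∅ : Finset V)]
  · rw [psi, hm, hm, hμ.2]; simp
  · intro R _ hR
    have : R.card ≠ 0 := by simpa using hR
    simp [this]
  · simp

lemma ent_nonneg (μ f : Conf V → ℝ) (hμ : IsDist μ) (hf : ∀ σ, 0 < f σ) : 0 ≤ entOf μ f := by
  have := dv μ f (fun _ => 1) hμ.1 hf (fun _ => one_pos) (by rw [hμ.2]; exact one_pos)
  simp only [Real.log_one, mul_zero, Finset.sum_const_zero, mul_one, hμ.2, sub_zero, zero_add]
    at this
  rw [entOf]; linarith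

lemma magC_eq (μ : Conf V → ℝ) (θ : ℝ) (σ : Conf V) :
    magnetizeC μ θ σ = μ σ * θ ^ plusCount σ / Zmag μ θ := by
  have : ∀ τ : Conf V, (∏ v : V, if τ v = true then θ else 1) = θ ^ plusCount τ := by
    intro τ
    rw [plusCount, plusSet, ← Finset.prod_filter, Finset.prod_const]
  simp only [magnetizeC, magnetize, this, Zmag]

lemma ite_magC (μ : Conf V → ℝ) (θ : ℝ) (R : Finset V) (σ : Conf V) (c : ℝ) :
    (if ∀ v ∈ R, σ v = true then magnetizeC μ θ σ / c else 0) =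
      (θ ^ R.card / Zmag μ θ) * (μ σ * bw R θ σ) / c := by
  have h : (∀ v ∈ R, σ v = true) ↔ R ⊆ plusSet σ := by
    simp only [Finset.subset_iff, mem_plusSet]
  simp only [h, bw]
  split_ifs with h
  · have : plusCount σ = R.card + (plusSet σ \ R).card := by
      rw [plusCount, add_comm, Finset.card_sdiff_add_card_eq_card h]
    rw [magC_eq, this, pow_add]
    ring
  · simp

lemma Z_pos (μ : Conf V → ℝ) (hμ : IsDist μ) (θ : ℝ) (h0 : 0 < θ) : 0 < Zmag μ θ :=
  sum_lt_of μ (fun σ => θ ^ plusCount σ) hμ.1 (fun σ => pow_pos h0 _) (by rw [hμ.2]; exact one_pos)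

lemma term_eq (μ f : Conf V → ℝ) (hμ : IsDist μ) (θ : ℝ) (h0 : 0 < θ)
    (R : Finset V) :
    (Zmag μ θ / θ ^ (Fintype.card V)) * (binWeight θ R * mbfTerm μ θ f R) =
    (1 - θ) ^ R.card * (mR (fun σ => μ σ * (f σ * Real.log (f σ))) R θ - psi μ f R θ) := by
  have hZ := (Z_pos μ hμ θ h0).ne'
  have hm : margin (magnetizeC μ θ) R (fun _ => true) = (θ ^ R.card / Zmag μ θ) * mR μ R θ := by
    rw [margin, mR, Finset.mul_sum]
    refine Finset.sum_congr rfl fun σ _ => ?_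
    have := ite_magC μ θ R σ 1
    simpa using this
  have hc0 : θ ^ R.card / Zmag μ θ ≠ 0 := by positivity
  have hc : ∀ σ, condDist (magnetizeC μ θ) R (fun _ => true) σ = μ σ * bw R θ σ / mR μ R θ := by
    intro σ
    rw [condDist, ite_magC, hm, mul_div_mul_left _ _ hc0]
  have hs : ∀ g : Conf V → ℝ, ∑ σ, μ σ * bw R θ σ / mR μ R θ * g σ =
      mR (fun σ => μ σ * g σ) R θ / mR μ R θ := by
    intro g
    generalize mR μ R θ = b
    rw [mR, Finset.sum_div]
    exact Finset.sum_congr rfl fun σ _ => by ring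
  have he : mR μ R θ * entOf (condDist (magnetizeC μ θ) R (fun _ => true)) f =
      mR (fun σ => μ σ * (f σ * Real.log (f σ))) R θ - psi μ f R θ := by
    rw [entOf]
    simp only [hc]
    rw [hs f, hs (fun σ => f σ * Real.log (f σ)), psi]
    by_cases hb : mR μ R θ = 0
    · have h1 := fun f => mR_zero μ f hμ.1 R R subset_rfl θ h0 hb θ
      rw [h1 f, h1 (fun σ => f σ * Real.log (f σ)), hb]; simp
    · field_simp
  rw [mbfTerm, hm, mul_assoc, he, binWeight]
  have hcard : Fintype.card V = (Fintype.card V - R.card) + R.card :=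
    (Nat.sub_add_cancel (Finset.card_le_univ R)).symm
  generalize mR (fun σ => μ σ * (f σ * Real.log (f σ))) R θ - psi μ f R θ = x
  have hpow : θ ^ Fintype.card V = θ ^ (Fintype.card V - R.card) * θ ^ R.card := by
    rw [← pow_add, ← hcard]
  rw [hpow]
  have p1 : θ ^ (Fintype.card V - R.card) ≠ 0 := pow_ne_zero _ h0.ne'
  have p2 : θ ^ R.card ≠ 0 := pow_ne_zero _ h0.ne'
  clear hcard hpow he hs hc hc0 hm
  generalize θ ^ (Fintype.card V - R.card) = P at *
  generalize θ ^ R.card = Q at *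
  generalize (1 - θ) ^ R.card = S at *
  field_simp

lemma cont_ent (ν f : Conf V → ℝ) : Continuous fun ε : ℝ => entOf ν (fun σ => f σ + ε) := by
  unfold entOf
  have h1 : ∀ σ, Continuous fun ε : ℝ => (f σ + ε) * Real.log (f σ + ε) := fun σ =>
    Real.continuous_mul_log.comp (by fun_prop : Continuous fun ε : ℝ => f σ + ε)
  have h2 : Continuous fun ε : ℝ => (∑ σ, ν σ * (f σ + ε)) * Real.log (∑ σ, ν σ * (f σ + ε)) :=
    Real.continuous_mul_log.comp (by fun_prop : Continuous fun ε : ℝ => ∑ σ, ν σ * (f σ + ε))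
  exact (continuous_finsetSum _ fun σ _ => (h1 σ).const_mul (ν σ)).sub h2

lemma mbf_pos (μ f : Conf V → ℝ) (hμ : IsDist μ) (hf : ∀ σ, 0 < f σ) (η : ℝ) (hη : 0 < η)
    (hSI : SIinfAllFields μ η) (θ : ℝ) (h0 : 0 < θ) (h1 : θ < 1) :
    entOf μ f ≤ (Real.exp 1 / θ) ^ (η + 3) * (Zmag μ θ / θ ^ (Fintype.card V)) *
      ∑ R : Finset V, binWeight θ R * mbfTerm μ θ f R := by
  have hg := F_growth μ f hμ hf η hη hSI θ h0 h1
  rw [F_one μ f hμ] at hg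
  have hpos : 0 < θ ^ (-(1 + η)) := Real.rpow_pos_of_pos h0 _
  have hF : 0 ≤ Ffun μ f θ := by
    have := (ent_nonneg μ f hμ hf).trans hg
    exact nonneg_of_mul_nonneg_right this hpos
  have e : (Zmag μ θ / θ ^ (Fintype.card V)) * ∑ R : Finset V, binWeight θ R * mbfTerm μ θ f R
      = Ffun μ f θ := by
    rw [Finset.mul_sum, Ffun_eq]
    exact Finset.sum_congr rfl fun R _ => term_eq μ f hμ θ h0 R
  rw [mul_assoc, e]
  refine hg.trans (mul_le_mul_of_nonneg_right ?_ hF)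
  have hi : 1 ≤ 1 / θ := (one_le_div h0).2 h1.le
  have he : 1 / θ ≤ Real.exp 1 / θ :=
    div_le_div_of_nonneg_right (Real.one_le_exp zero_le_one) h0.le
  calc θ ^ (-(1 + η)) = (1 / θ) ^ (1 + η) := by
        rw [Real.rpow_neg h0.le, one_div, Real.inv_rpow h0.le]
    _ ≤ (1 / θ) ^ (η + 3) := Real.rpow_le_rpow_of_exponent_le hi (by linarith)
    _ ≤ _ := Real.rpow_le_rpow (by positivity) he (by linarith)

end helpers

/-- Spectral independence in `∞`-norm with all fields implies
`θ`-magnetized block factorization of entropy with parameter `C = (e/θ)^{η+3}`. -/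
theorem si_implies_mbf {V : Type*} [Fintype V] [DecidableEq V]
    (μ : Conf V → ℝ) (hμ : IsDist μ) (η : ℝ) (hη : 0 < η)
    (hSI : SIinfAllFields μ η) :
    ∀ θ : ℝ, 0 < θ → θ < 1 → MBF μ θ ((Real.exp 1 / θ) ^ (η + 3)) := by
  intro θ h0 h1 f hf
  refine le_of_tendsto_of_tendsto (b := nhdsWithin (0:ℝ) (Set.Ioi 0))
    (f := fun ε : ℝ => entOf μ (fun σ => f σ + ε))
    (g := fun ε : ℝ => (Real.exp 1 / θ) ^ (η + 3) * (Zmag μ θ / θ ^ (Fintype.card V)) *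
      ∑ R : Finset V, binWeight θ R * mbfTerm μ θ (fun σ => f σ + ε) R) ?_ ?_ ?_
  · have := ((cont_ent μ f).tendsto 0).mono_left (nhdsWithin_le_nhds (s := Set.Ioi 0))
    simpa using this
  · have hc : Continuous fun ε : ℝ =>
        (Real.exp 1 / θ) ^ (η + 3) * (Zmag μ θ / θ ^ (Fintype.card V)) *
        ∑ R : Finset V, binWeight θ R * mbfTerm μ θ (fun σ => f σ + ε) R := by
      refine continuous_const.mul (continuous_finsetSum _ fun R _ => continuous_const.mul ?_)
      unfold mbfTerm
      exact continuous_const.mul (cont_ent _ f)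
    have := (hc.tendsto 0).mono_left (nhdsWithin_le_nhds (s := Set.Ioi 0))
    simpa using this
  · filter_upwards [self_mem_nhdsWithin] with ε hε
    exact mbf_pos μ _ hμ (fun σ => add_pos_of_nonneg_of_pos (hf σ) hε) η hη hSI θ h0 h1
end
end

section
/- Let μ be a distribution over {-1,+1}^V and η > 0. If μ is η-spectrally independent in ∞-norm with all fields, then for every integer k ≥ 1, the k-transformed distribution μ_k = Trans(μ, k) over {-1,+1}^{V×[k]} is (η+1)-spectrally independent in ∞-norm with all fields. -/
open Classical Finset

noncomputable section

open PaperIsing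


namespace KTransAux

variable {V : Type*} [Fintype V] [DecidableEq V]

/-- weight -/
def W {A : Type*} [Fintype A] (x : A → ℝ) (σ : Conf A) : ℝ := ∏ v : A, if σ v then x v else 1

lemma W_mul {A : Type*} [Fintype A] (x c : A → ℝ) (σ : Conf A) :
    W (fun a => x a * c a) σ = W x σ * W c σ := by
  unfold W
  rw [← Finset.prod_mul_distrib]
  refine Finset.prod_congr rfl fun a _ => ?_
  split_ifs <;> simp

lemma W_two {A : Type*} [Fintype A] [DecidableEq A] (a b : A) (hab : a ≠ b) (s t : ℝ) (σ : Conf A) :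
    W (fun z => if z = a then s else if z = b then t else 1) σ
      = (if σ a then s else 1) * (if σ b then t else 1) := by
  unfold W
  have : ∀ z, (if σ z then (if z = a then s else if z = b then t else 1) else 1)
      = (if z = a then (if σ a then s else 1) else 1) * (if z = b then (if σ b then t else 1) else 1) := by
    intro z
    by_cases h1 : z = a
    · subst h1; simp [hab]
    · by_cases h2 : z = b
      · subst h2; simp [h1]
      · simp [h1, h2]
  rw [Finset.prod_congr rfl (fun z _ => this z), Finset.prod_mul_distrib]
  simp

/-- encode -/
def enc {k : ℕ} (f : V → Option (Fin k)) : Conf (V × Fin k) := fun p => decide (f p.1 = some p.2)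

lemma kstar_enc {k : ℕ} (f : V → Option (Fin k)) : kstar (enc f) = fun v => (f v).isSome := by
  funext v
  unfold kstar enc
  cases h : f v <;> simp [h]

lemma enc_inj {k : ℕ} : Function.Injective (enc : (V → Option (Fin k)) → _) := by
  intro f g h
  funext v
  ext j
  have := congrFun h (v, j)
  simpa [enc] using this

lemma enc_valid {k : ℕ} (f : V → Option (Fin k)) (v : V) :
    (Finset.univ.filter (fun i : Fin k => enc f (v, i) = true)).card ≤ 1 := by
  rw [Finset.card_le_one]
  intro a ha b hb
  simp [enc] at ha hb
  rw [ha] at hb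
  simpa using hb

lemma exists_enc {k : ℕ} (τ : Conf (V × Fin k))
    (h : ∀ v : V, (Finset.univ.filter (fun i : Fin k => τ (v, i) = true)).card ≤ 1) :
    ∃ f, enc f = τ := by
  have : ∀ v : V, ∃ o : Option (Fin k), ∀ j, (o = some j ↔ τ (v, j) = true) := by
    intro v
    by_cases hv : ∃ i, τ (v, i) = true
    · obtain ⟨i, hi⟩ := hv
      refine ⟨some i, fun j => ⟨?_, fun hj => ?_⟩⟩
      · rintro h; cases h; exact hi
      · have := Finset.card_le_one.1 (h v) i (by simp [hi]) j (by simp [hj])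
        rw [this]
    · refine ⟨none, fun j => ?_⟩
      push Not at hv
      simp [hv j]
  choose f hf using this
  refine ⟨f, ?_⟩
  funext ⟨v, j⟩
  have := hf v j
  unfold enc
  cases h : τ (v, j) <;> simp_all

lemma base (H : Conf V → ℝ) (k : ℕ) (x : V × Fin k → ℝ) :
    ∑ τ, ktrans H k τ * W x τ = ∑ σ, H σ * W (fun v => (∑ j, x (v, j)) / k) σ := by
  let g : V → Option (Fin k) → ℝ := fun v o => o.elim 1 (fun j => x (v, j) / k)
  have hR : ∀ σ : Conf V, W (fun v => (∑ j, x (v, j)) / k) σ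
      = ∑ f : V → Option (Fin k), ∏ v, (if (f v).isSome = σ v then g v (f v) else 0) := by
    intro σ
    unfold W
    rw [← Fintype.prod_sum (fun v o => if o.isSome = σ v then g v o else 0)]
    refine Finset.prod_congr rfl fun v _ => ?_
    rw [Fintype.sum_option]
    cases h : σ v <;> simp [g, Finset.sum_div]
  have hR2 : ∑ σ, H σ * W (fun v => (∑ j, x (v, j)) / k) σ
      = ∑ f : V → Option (Fin k), H (fun v => (f v).isSome) * ∏ v, g v (f v) := by
    simp_rw [hR, Finset.mul_sum]
    rw [Finset.sum_comm]
    refine Finset.sum_congr rfl fun f _ => ?_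
    rw [Finset.sum_eq_single (fun v => (f v).isSome)]
    · simp
    · intro σ _ hne
      obtain ⟨v, hv⟩ := Function.ne_iff.1 hne
      rw [Finset.prod_eq_zero (Finset.mem_univ v), mul_zero]
      rw [if_neg]
      exact fun h => hv h.symm
    · simp
  rw [hR2]
  symm
  refine Fintype.sum_of_injective enc enc_inj _ _ ?_ ?_
  · intro τ hτ
    unfold ktrans
    rw [if_neg, zero_mul]
    intro h
    exact hτ (exists_enc τ h)
  · intro f
    unfold ktrans
    rw [if_pos (enc_valid f), kstar_enc, mul_assoc]
    congr 1
    unfold plusCount plusSet W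
    rw [← Finset.prod_const, Finset.prod_filter, Fintype.prod_prod_type, ← Finset.prod_mul_distrib]
    refine Finset.prod_congr rfl fun v _ => ?_
    cases h : f v with
    | none => simp [g, enc, h]
    | some i =>
      simp [g, enc, h]
      ring

lemma magW {A : Type*} [Fintype A] [DecidableEq A] (μ : Conf A → ℝ) (x : A → ℝ) (σ : Conf A) :
    magnetize μ x σ = μ σ * W x σ / ∑ τ, μ τ * W x τ := rfl

/-- fields -/
def yy {k : ℕ} (x : V × Fin k → ℝ) (v : V) : ℝ := (∑ j, x (v, j)) / k

lemma base2 (μ : Conf V → ℝ) (k : ℕ) (hk : 1 ≤ k) (x c : V × Fin k → ℝ) (hx : ∀ a, 0 < x a) :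
    ∑ τ, magnetize (ktrans μ k) x τ * W c τ
      = ∑ σ, magnetize μ (yy x) σ *
          W (fun v => ∑ j, x (v, j) / (∑ j, x (v, j)) * c (v, j)) σ := by
  simp_rw [magW, div_mul_eq_mul_div, mul_assoc, ← Finset.sum_div, ← W_mul]
  rw [base, base]
  congr 1
  refine Finset.sum_congr rfl fun σ _ => ?_
  congr 2
  funext v
  haveI : Nonempty (Fin k) := ⟨⟨0, hk⟩⟩
  have h1 : 0 < ∑ j, x (v, j) := Finset.sum_pos (fun j _ => hx _) Finset.univ_nonempty
  have h2 : (0:ℝ) < k := by exact_mod_cast hk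
  unfold yy
  field_simp

lemma two (μ : Conf V → ℝ) (k : ℕ) (hk : 1 ≤ k) (x : V × Fin k → ℝ) (hx : ∀ a, 0 < x a)
    (u v : V) (i j : Fin k) (huv : u ≠ v) (s t : ℝ) :
    ∑ τ, magnetize (ktrans μ k) x τ * ((if τ (u, i) then s else 1) * (if τ (v, j) then t else 1))
      = ∑ σ, magnetize μ (yy x) σ *
         ((if σ u then 1 + x (u, i) / (∑ j, x (u, j)) * (s - 1) else 1) *
          (if σ v then 1 + x (v, j) / (∑ j, x (v, j)) * (t - 1) else 1)) := by
  have hne : ((u, i) : V × Fin k) ≠ (v, j) := by simp [huv]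
  simp_rw [← W_two _ _ hne, ← W_two _ _ huv]
  rw [base2 μ k hk x _ hx]
  refine Finset.sum_congr rfl fun σ _ => ?_
  congr 2
  funext z
  haveI : Nonempty (Fin k) := ⟨⟨0, hk⟩⟩
  have h1 : ∀ v, ∑ j, x (v, j) ≠ 0 :=
    fun v => (Finset.sum_pos (fun j _ => hx _) Finset.univ_nonempty).ne'
  have key : ∀ (v : V) (i : Fin k) (s : ℝ),
      ∑ j, x (v, j) / (∑ j, x (v, j)) * (if j = i then s else 1)
        = 1 + x (v, i) / (∑ j, x (v, j)) * (s - 1) := by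
    intro v i s
    have : ∀ j, x (v, j) / (∑ j, x (v, j)) * (if j = i then s else 1)
       = x (v, j) / (∑ j, x (v, j)) + (if j = i then x (v, i) / (∑ j, x (v, j)) * (s - 1) else 0) := by
      intro j
      split_ifs with h
      · subst h; ring
      · ring
    rw [Finset.sum_congr rfl (fun j _ => this j), Finset.sum_add_distrib, ← Finset.sum_div,
      div_self (h1 v)]
    simp
  by_cases hzu : z = u
  · subst hzu
    simpa [huv] using key z i s
  · by_cases hzv : z = v
    · subst hzv
      simpa [hzu] using key z j t
    · simp [hzu, hzv, ← Finset.sum_div, div_self (h1 z)]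

lemma mag_nonneg {A : Type*} [Fintype A] [DecidableEq A] (μ : Conf A → ℝ) (hμ : ∀ a, 0 ≤ μ a) (x : A → ℝ)
    (hx : ∀ a, 0 < x a) (σ : Conf A) : 0 ≤ magnetize μ x σ := by
  have hW : ∀ σ, 0 ≤ W x σ := by
    intro σ
    refine Finset.prod_nonneg fun a _ => ?_
    split_ifs
    · exact (hx a).le
    · exact zero_le_one
  rw [magW]
  exact div_nonneg (mul_nonneg (hμ _) (hW _))
    (Finset.sum_nonneg fun _ _ => mul_nonneg (hμ _) (hW _))

lemma arith (p q T F Tv Fv : ℝ) (hq : 0 ≤ q) (hp : p ≤ 1) (hT : 0 < p * T) (hp0 : 0 < p)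
    (hA : 0 < (1 - p) * T + F) (hF : 0 ≤ F) (hFF : F = 0 → Fv = 0) :
    |p * q * Tv / (p * T) - q * ((1 - p) * Tv + Fv) / ((1 - p) * T + F)|
      ≤ q * (if 0 < T ∧ 0 < F then |Tv / T - Fv / F| else 0) := by
  have hT' : 0 < T := by
    by_contra h
    push Not at h
    nlinarith
  by_cases h0 : F = 0
  · have := hFF h0
    subst h0
    rw [this]
    have h1p : 1 - p ≠ 0 := by rintro h; simp [h] at hA
    simp
    rw [sub_eq_zero]
    field_simp
  · have hFp : 0 < F := lt_of_le_of_ne hF (Ne.symm h0)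
    rw [if_pos ⟨hT', hFp⟩]
    have : p * q * Tv / (p * T) - q * ((1 - p) * Tv + Fv) / ((1 - p) * T + F)
      = q * ((F / ((1 - p) * T + F)) * (Tv / T - Fv / F)) := by
      have hA' := hA.ne'
      have hp' := hp0.ne'
      generalize hG : (1 - p) * T + F = G at hA'
      have hFe : F = G - (1 - p) * T := by rw [← hG]; ring
      field_simp
      rw [hFe]
      ring
    rw [this, abs_mul, abs_of_nonneg hq, abs_mul, abs_of_nonneg (by positivity)]
    refine mul_le_mul_of_nonneg_left ?_ hq
    refine mul_le_of_le_one_left (abs_nonneg _) ?_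
    rw [div_le_one hA]
    nlinarith

lemma diag (μ : Conf V → ℝ) (hμ : ∀ a, 0 ≤ μ a) (k : ℕ) (x : V × Fin k → ℝ) (hx : ∀ a, 0 < x a)
    (u : V) (i : Fin k) :
    ∑ j, |infl (magnetize (ktrans μ k) x) (u, i) (u, j)| ≤ 1 := by
  set ν := magnetize (ktrans μ k) x with hν
  have hν0 : ∀ τ, 0 ≤ ν τ := by
    refine mag_nonneg _ ?_ _ hx
    intro τ
    unfold ktrans
    split_ifs
    · exact mul_nonneg (hμ _) (by positivity)
    · exact le_rfl
  have hνz : ∀ τ j j', τ (u, j) = true → τ (u, j') = true → j ≠ j' → ν τ = 0 := by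
    intro τ j j' h h' hne
    rw [hν, magW]
    unfold ktrans
    rw [if_neg]
    · simp
    · intro hc
      exact hne (Finset.card_le_one.1 (hc u) j (by simp [h]) j' (by simp [h']))
  by_cases hpos : 0 < (∑ σ, if σ (u, i) = true then ν σ else 0) ∧
      0 < (∑ σ, if σ (u, i) = false then ν σ else 0)
  swap
  · have : ∀ j, infl ν (u, i) (u, j) = 0 := by
      intro j
      unfold infl
      rw [if_neg]
      exact fun h => hpos h.2
    simp [this]
  set D := (∑ σ, if σ (u, i) = false then ν σ else 0) with hD
  have hle : ∀ j, |infl ν (u, i) (u, j)|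
      ≤ (∑ σ, if σ (u, i) = false ∧ σ (u, j) = true then ν σ else 0) / D := by
    intro j
    have hn : 0 ≤ (∑ σ, if σ (u, i) = false ∧ σ (u, j) = true then ν σ else 0) / D := by
      refine div_nonneg (Finset.sum_nonneg fun σ _ => ?_) hpos.2.le
      split_ifs
      · exact hν0 σ
      · exact le_rfl
    unfold infl
    split_ifs with h
    · have hij : i ≠ j := fun e => h.1 (by rw [e])
      unfold condPlusProb
      rw [show (∑ σ, if σ (u, i) = true ∧ σ (u, j) = true then ν σ else 0) = 0 from ?_]
      · rw [zero_div, zero_sub, abs_neg, abs_of_nonneg hn]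
      · refine Finset.sum_eq_zero fun σ _ => ?_
        split_ifs with h2
        · exact hνz σ i j h2.1 h2.2 hij
        · rfl
    · simpa using hn
  refine (Finset.sum_le_sum fun j _ => hle j).trans ?_
  rw [← Finset.sum_div, div_le_one hpos.2, Finset.sum_comm, hD]
  refine Finset.sum_le_sum fun σ _ => ?_
  by_cases h : σ (u, i) = false
  · simp only [h, true_and, if_true]
    by_cases he : ∃ j, σ (u, j) = true
    · obtain ⟨j, hj⟩ := he
      rw [Finset.sum_eq_single j]
      · simp [hj]
      · intro b _ hb
        split_ifs with h2
        · exact hνz σ b j h2 hj hb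
        · rfl
      · simp
    · push Not at he
      simpa [he] using hν0 σ
  · simp [h]

lemma offdiag (μ : Conf V → ℝ) (hμ : ∀ a, 0 ≤ μ a) (k : ℕ) (hk : 1 ≤ k)
    (x : V × Fin k → ℝ) (hx : ∀ a, 0 < x a)
    (u v : V) (i j : Fin k) (huv : u ≠ v) :
    |infl (magnetize (ktrans μ k) x) (u, i) (v, j)|
      ≤ x (v, j) / (∑ j, x (v, j)) * |infl (magnetize μ (yy x)) u v| := by
  haveI : Nonempty (Fin k) := ⟨⟨0, hk⟩⟩
  have hs : ∀ v, 0 < ∑ j, x (v, j) :=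
    fun v => Finset.sum_pos (fun j _ => hx _) Finset.univ_nonempty
  have hk' : (0:ℝ) < k := by exact_mod_cast hk
  have hy : ∀ v, 0 < yy x v := fun v => div_pos (hs v) hk'
  have hπ0 := mag_nonneg μ hμ (yy x) hy
  have h2 := two μ k hk x hx u v i j huv
  set ν := magnetize (ktrans μ k) x
  set π := magnetize μ (yy x)
  set p := x (u, i) / (∑ j, x (u, j)) with hpd
  set q := x (v, j) / (∑ j, x (v, j)) with hqd
  have hp0 : 0 < p := div_pos (hx _) (hs u)
  have hq0 : 0 < q := div_pos (hx _) (hs v)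
  have hp1 : p ≤ 1 := by
    rw [hpd, div_le_one (hs u)]
    exact Finset.single_le_sum (f := fun j => x (u, j)) (fun j _ => (hx _).le) (Finset.mem_univ i)
  set T := ∑ σ, if σ u = true then π σ else 0 with hT
  set F := ∑ σ, if σ u = false then π σ else 0 with hF
  set Tv := ∑ σ, if σ u = true ∧ σ v = true then π σ else 0 with hTv
  set Fv := ∑ σ, if σ u = false ∧ σ v = true then π σ else 0 with hFv
  have e00 := h2 0 0
  have e01 := h2 0 1
  have e10 := h2 1 0
  have e11 := h2 1 1
  have A1 : (∑ τ, if τ (u, i) = true then ν τ else 0) = p * T := by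
    have l : (∑ τ, if τ (u, i) = true then ν τ else 0) =
      (∑ τ, ν τ * ((if τ (u, i) then (1:ℝ) else 1) * (if τ (v, j) then (1:ℝ) else 1)))
      - (∑ τ, ν τ * ((if τ (u, i) then (0:ℝ) else 1) * (if τ (v, j) then (1:ℝ) else 1))) := by
      rw [← Finset.sum_sub_distrib]
      refine Finset.sum_congr rfl fun τ _ => ?_
      cases τ (u, i) <;> cases τ (v, j) <;> simp
    rw [l, e11, e01, ← Finset.sum_sub_distrib, hT, Finset.mul_sum]
    refine Finset.sum_congr rfl fun σ _ => ?_
    cases σ u <;> cases σ v <;> simp <;> ring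
  have A0 : (∑ τ, if τ (u, i) = false then ν τ else 0) = (1 - p) * T + F := by
    have l : (∑ τ, if τ (u, i) = false then ν τ else 0) =
      (∑ τ, ν τ * ((if τ (u, i) then (0:ℝ) else 1) * (if τ (v, j) then (1:ℝ) else 1))) := by
      refine Finset.sum_congr rfl fun τ _ => ?_
      cases τ (u, i) <;> cases τ (v, j) <;> simp
    rw [l, e01, hT, hF, Finset.mul_sum, ← Finset.sum_add_distrib]
    refine Finset.sum_congr rfl fun σ _ => ?_
    cases σ u <;> cases σ v <;> simp <;> ring
  have B0 : (∑ τ, if τ (u, i) = false ∧ τ (v, j) = true then ν τ else 0)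
      = q * ((1 - p) * Tv + Fv) := by
    have l : (∑ τ, if τ (u, i) = false ∧ τ (v, j) = true then ν τ else 0) =
      (∑ τ, ν τ * ((if τ (u, i) then (0:ℝ) else 1) * (if τ (v, j) then (1:ℝ) else 1)))
      - (∑ τ, ν τ * ((if τ (u, i) then (0:ℝ) else 1) * (if τ (v, j) then (0:ℝ) else 1))) := by
      rw [← Finset.sum_sub_distrib]
      refine Finset.sum_congr rfl fun τ _ => ?_
      cases τ (u, i) <;> cases τ (v, j) <;> simp
    rw [l, e01, e00, ← Finset.sum_sub_distrib, hTv, hFv, Finset.mul_sum, ← Finset.sum_add_distrib,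
      Finset.mul_sum]
    refine Finset.sum_congr rfl fun σ _ => ?_
    cases σ u <;> cases σ v <;> simp <;> ring
  have B1 : (∑ τ, if τ (u, i) = true ∧ τ (v, j) = true then ν τ else 0)
      = p * q * Tv := by
    have l : (∑ τ, if τ (u, i) = true ∧ τ (v, j) = true then ν τ else 0) =
      ((∑ τ, ν τ * ((if τ (u, i) then (1:ℝ) else 1) * (if τ (v, j) then (1:ℝ) else 1)))
      - (∑ τ, ν τ * ((if τ (u, i) then (1:ℝ) else 1) * (if τ (v, j) then (0:ℝ) else 1))))
      - ((∑ τ, ν τ * ((if τ (u, i) then (0:ℝ) else 1) * (if τ (v, j) then (1:ℝ) else 1)))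
      - (∑ τ, ν τ * ((if τ (u, i) then (0:ℝ) else 1) * (if τ (v, j) then (0:ℝ) else 1)))) := by
      simp only [← Finset.sum_sub_distrib]
      refine Finset.sum_congr rfl fun τ _ => ?_
      cases τ (u, i) <;> cases τ (v, j) <;> simp
    rw [l, e01, e00, e11, e10]
    simp only [← Finset.sum_sub_distrib]
    rw [hTv, Finset.mul_sum]
    refine Finset.sum_congr rfl fun σ _ => ?_
    cases σ u <;> cases σ v <;> simp <;> ring
  have hF0 : 0 ≤ F := Finset.sum_nonneg fun σ _ => by
    split_ifs
    · exact hπ0 σ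
    · exact le_rfl
  have hFF : F = 0 → Fv = 0 := by
    intro h
    refine le_antisymm ?_ (Finset.sum_nonneg fun σ _ => ?_)
    · rw [← h]
      refine Finset.sum_le_sum fun σ _ => ?_
      have := hπ0 σ
      cases σ u <;> cases σ v <;> simp [this]
    · split_ifs
      · exact hπ0 σ
      · exact le_rfl
  have hinf : |infl π u v| = if 0 < T ∧ 0 < F then |Tv / T - Fv / F| else 0 := by
    unfold infl condPlusProb
    simp only [ne_eq, huv, not_false_eq_true, true_and]
    split_ifs <;> simp [hT, hF, hTv, hFv]
  rw [hinf]
  unfold infl condPlusProb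
  rw [A1, A0, B1, B0]
  split_ifs with h h'
  · have := arith p q T F Tv Fv hq0.le hp1 h.2.1 hp0 h.2.2 hF0 hFF
    rwa [if_pos h'] at this
  · have := arith p q T F Tv Fv hq0.le hp1 h.2.1 hp0 h.2.2 hF0 hFF
    rwa [if_neg h'] at this
  · rw [abs_zero]; positivity
  · simp

end KTransAux

/-- If `μ` is `η`-spectrally independent in `∞`-norm with all fields, then
for every `k ≥ 1` the `k`-transformed distribution `μ_k = Trans(μ,k)` is
`(η+1)`-spectrally independent in `∞`-norm with all fields. -/
theorem ktrans_si {V : Type*} [Fintype V] [DecidableEq V]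
    (μ : Conf V → ℝ) (hμ : IsDist μ) (η : ℝ) (hη : 0 < η)
    (hSI : SIinfAllFields μ η) :
    ∀ k : ℕ, 1 ≤ k → SIinfAllFields (ktrans μ k) (η + 1) := by
  intro k hk x hx
  rintro ⟨u, i⟩
  haveI : Nonempty (Fin k) := ⟨⟨0, hk⟩⟩
  have hs : ∀ v, 0 < ∑ j, x (v, j) :=
    fun v => Finset.sum_pos (fun j _ => hx _) Finset.univ_nonempty
  have hk' : (0:ℝ) < k := by exact_mod_cast hk
  have hy : ∀ v, 0 < KTransAux.yy x v := fun v => div_pos (hs v) hk'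
  have hS := hSI (KTransAux.yy x) hy u
  rw [Fintype.sum_prod_type, ← Finset.add_sum_erase _ _ (Finset.mem_univ u), add_comm]
  refine add_le_add ?_ (KTransAux.diag μ hμ.1 k x hx u i)
  refine le_trans ?_ hS
  refine le_trans ?_ (Finset.sum_le_sum_of_subset_of_nonneg (Finset.erase_subset u Finset.univ)
    (fun _ _ _ => abs_nonneg _))
  refine Finset.sum_le_sum fun v hv => ?_
  have huv : u ≠ v := (Finset.ne_of_mem_erase hv).symm
  refine (Finset.sum_le_sum fun j _ =>
    KTransAux.offdiag μ hμ.1 k hk x hx u v i j huv).trans ?_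
  rw [← Finset.sum_mul, ← Finset.sum_div, div_self (hs v).ne', one_mul]
end
end

section
/- Let μ be a distribution over {-1,+1}^V and η > 0. If for every integer k ≥ 1, the k-transformed distribution μ_k = Trans(μ, k) is η-spectrally independent in ∞-norm with all fields, then for every θ ∈ (0,1), μ satisfies θ-magnetized block factorization of entropy with parameter C = (e/θ)^{η+2}. -/
open Classical Finset

noncomputable section

open PaperIsing

namespace MBFProof

variable {V : Type*} [Fintype V] [DecidableEq V]

def XX (b : Bool) : ℝ := if b then 1 else 0

lemma XX_nonneg (b : Bool) : 0 ≤ XX b := by cases b <;> simp [XX]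

def Good (κ : ℝ) (w : Conf V → ℝ) : Prop :=
  ∀ x : V → ℝ, (∑ σ, w σ * (∑ v, x v * XX (σ v)) ^ 2) * (∑ σ, w σ)
      - (∑ σ, w σ * ∑ v, x v * XX (σ v)) ^ 2
    ≤ κ * (∑ v, x v ^ 2 * ∑ σ, w σ * XX (σ v)) * ∑ σ, w σ

lemma good_smul {κ : ℝ} {w : Conf V → ℝ} (h : Good κ w) (c : ℝ) :
    Good κ (fun σ => c * w σ) := by
  intro x
  have h1 := mul_le_mul_of_nonneg_left (h x) (sq_nonneg c)
  simp only [mul_assoc c, ← Finset.mul_sum]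
  have : (∑ v, x v ^ 2 * (c * ∑ σ, w σ * XX (σ v)))
      = c * (∑ v, x v ^ 2 * (∑ σ, w σ * XX (σ v))) := by
    rw [Finset.mul_sum]; exact Finset.sum_congr rfl fun v _ => by ring
  rw [this]
  nlinarith [h1]

lemma good_of_SI {η : ℝ} (p : Conf V → ℝ) (hp : IsDist p) (h : SIinf p η) :
    Good (1 + η) p := by
  obtain ⟨hp0, hp1⟩ := hp
  set P : V → ℝ := fun u => ∑ σ, p σ * XX (σ u) with hP
  set Q : V → V → ℝ := fun u v => ∑ σ, p σ * (XX (σ u) * XX (σ v)) with hQ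
  have hP0 : ∀ u, 0 ≤ P u := fun u =>
    Finset.sum_nonneg fun σ _ => mul_nonneg (hp0 σ) (XX_nonneg _)
  have eT : ∀ u, (∑ σ : Conf V, if σ u = true then p σ else 0) = P u := by
    intro u
    refine Finset.sum_congr rfl fun σ _ => ?_
    cases hh : σ u <;> simp [XX]
  have eF : ∀ u, (∑ σ : Conf V, if σ u = false then p σ else 0) = 1 - P u := by
    intro u
    rw [← hp1, hP, ← Finset.sum_sub_distrib]
    refine Finset.sum_congr rfl fun σ _ => ?_
    cases hh : σ u <;> simp [XX]
  have eTT : ∀ u v, (∑ σ : Conf V, if σ u = true ∧ σ v = true then p σ else 0) = Q u v := by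
    intro u v
    refine Finset.sum_congr rfl fun σ _ => ?_
    cases hh : σ u <;> cases hh : σ v <;> simp [XX]
  have eFT : ∀ u v, (∑ σ : Conf V, if σ u = false ∧ σ v = true then p σ else 0)
      = P v - Q u v := by
    intro u v
    rw [hP, hQ, ← Finset.sum_sub_distrib]
    refine Finset.sum_congr rfl fun σ _ => ?_
    cases hh : σ u <;> cases hh : σ v <;> simp [XX]
  have hQuu : ∀ u, Q u u = P u := by
    intro u
    refine Finset.sum_congr rfl fun σ _ => ?_
    cases hh : σ u <;> simp [XX]
  have hQ0 : ∀ u v, 0 ≤ Q u v := fun u v =>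
    Finset.sum_nonneg fun σ _ => mul_nonneg (hp0 σ) (mul_nonneg (XX_nonneg _) (XX_nonneg _))
  have hQs : ∀ u v, Q u v = Q v u := fun u v =>
    Finset.sum_congr rfl fun σ _ => by ring
  have hQP : ∀ u v, Q u v ≤ P u := fun u v =>
    Finset.sum_le_sum fun σ _ => by
      have := hp0 σ
      cases hh : σ u <;> cases hh : σ v <;> simp [XX, this]
  have hPQ0 : ∀ u v, 0 ≤ (1 - P u) - (P v - Q u v) := by
    intro u v
    rw [← eFT, ← eF, ← Finset.sum_sub_distrib]
    refine Finset.sum_nonneg fun σ _ => ?_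
    have := hp0 σ
    cases hh : σ u <;> cases hh : σ v <;> simp [this]
  have hPQ1 : ∀ u v, 0 ≤ P v - Q u v := by
    intro u v
    have := hQP v u
    rw [hQs] at this; linarith
  -- entrywise bound
  have hent : ∀ u v, |Q u v - P u * P v| ≤ P u * ((if u = v then 1 else 0) + |infl p u v|) := by
    intro u v
    have hP1 : 0 ≤ 1 - P u := by linarith [hPQ0 u v, hPQ1 u v]
    by_cases huv : u = v
    · subst huv
      rw [hQuu]
      have : |P u - P u * P u| ≤ P u := by
        rw [abs_of_nonneg (by nlinarith [hP0 u])]; nlinarith [hP0 u]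
      simp only [if_true]
      nlinarith [hP0 u, abs_nonneg (infl p u u), mul_nonneg (hP0 u) (abs_nonneg (infl p u u))]
    · rw [if_neg huv, zero_add]
      rcases (hP0 u).eq_or_lt with h0 | h0
      · have : Q u v = 0 := le_antisymm (h0 ▸ hQP u v) (hQ0 u v)
        simp [this, ← h0]
      rcases hP1.eq_or_lt with h1 | h1
      · have e1 : P u = 1 := by linarith
        have e2 : Q u v = P v := by linarith [hPQ0 u v, hPQ1 u v]
        rw [e1, e2]; simp
      have : infl p u v = (Q u v - P u * P v) / (P u * (1 - P u)) := by
        unfold infl condPlusProb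
        rw [eT, eF, eTT, eFT, if_pos ⟨huv, h0, h1⟩]
        field_simp
        ring
      rw [this, abs_div, abs_of_pos (mul_pos h0 h1)]
      rw [mul_div_assoc', le_div_iff₀ (mul_pos h0 h1)]
      have := mul_nonneg (abs_nonneg (Q u v - P u * P v)) (mul_nonneg h0.le h0.le)
      nlinarith
  have hrow : ∀ u, ∑ v, |Q u v - P u * P v| ≤ P u * (1 + η) := by
    intro u
    calc _ ≤ ∑ v, P u * ((if u = v then 1 else 0) + |infl p u v|) :=
          Finset.sum_le_sum fun v _ => hent u v
      _ = P u * (1 + ∑ v, |infl p u v|) := by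
          rw [← Finset.mul_sum, Finset.sum_add_distrib]; simp
      _ ≤ _ := mul_le_mul_of_nonneg_left (by linarith [h u]) (hP0 u)
  intro x
  have e1 : (∑ σ, p σ * (∑ v, x v * XX (σ v)) ^ 2) = ∑ u, ∑ v, x u * x v * Q u v := by
    simp only [hQ, sq, Finset.sum_mul_sum]
    simp only [Finset.mul_sum]
    rw [Finset.sum_comm]
    refine Finset.sum_congr rfl fun u _ => ?_
    rw [Finset.sum_comm]
    exact Finset.sum_congr rfl fun v _ => Finset.sum_congr rfl fun σ _ => by ring
  have e2 : (∑ σ, p σ * ∑ v, x v * XX (σ v)) = ∑ u, x u * P u := by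
    simp only [hP, Finset.mul_sum]
    rw [Finset.sum_comm]
    exact Finset.sum_congr rfl fun v _ => Finset.sum_congr rfl fun σ _ => by ring
  rw [hp1, mul_one, mul_one, e1, e2, sq, Finset.sum_mul_sum, ← Finset.sum_sub_distrib]
  simp only [← Finset.sum_sub_distrib]
  set c : V → V → ℝ := fun u v => |Q u v - P u * P v| with hc
  have hcs : ∀ u v, c u v = c v u := fun u v => by
    simp only [hc]; rw [hQs u v, mul_comm (P u)]
  calc _ ≤ ∑ u, ∑ v, (x u ^ 2 * c u v / 2 + x v ^ 2 * c v u / 2) := by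
        refine Finset.sum_le_sum fun u _ => Finset.sum_le_sum fun v _ => ?_
        have h1 : x u * x v * Q u v - x u * P u * (x v * P v)
          = (x u * x v) * (Q u v - P u * P v) := by ring
        rw [h1, ← hcs u v]
        have h2 : (x u * x v) * (Q u v - P u * P v) ≤ |x u * x v| * c u v := by
          rw [hc]; simp only; rw [← abs_mul]; exact le_abs_self _
        have h3 : |x u * x v| ≤ (x u ^ 2 + x v ^ 2) / 2 := by
          rw [abs_le]; constructor <;> nlinarith [sq_nonneg (x u - x v), sq_nonneg (x u + x v)]
        have h4 := mul_le_mul_of_nonneg_right h3 (abs_nonneg (Q u v - P u * P v))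
        simp only [hc] at *
        linarith
    _ = ∑ u, x u ^ 2 * ∑ v, c u v := by
        simp only [Finset.sum_add_distrib]
        rw [Finset.sum_comm (f := fun u v => x v ^ 2 * c v u / 2), ← Finset.sum_add_distrib]
        refine Finset.sum_congr rfl fun u _ => ?_
        rw [← Finset.sum_add_distrib, Finset.mul_sum]
        exact Finset.sum_congr rfl fun v _ => by ring
    _ ≤ ∑ u, x u ^ 2 * (P u * (1 + η)) :=
        Finset.sum_le_sum fun u _ => mul_le_mul_of_nonneg_left (hrow u) (sq_nonneg _)
    _ = _ := by
        rw [Finset.mul_sum]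
        exact Finset.sum_congr rfl fun v _ => by ring

lemma good_of_SIall {η : ℝ} (μ : Conf V → ℝ) (hμ : IsDist μ) (h : SIinfAllFields μ η)
    (lam : V → ℝ) (hl : ∀ v, 0 < lam v) :
    Good (1 + η) (fun σ => μ σ * ∏ v : V, if σ v then lam v else 1) := by
  set D := ∑ τ : Conf V, μ τ * ∏ v : V, if τ v then lam v else 1 with hD
  have hpr : ∀ τ : Conf V, 0 < ∏ v : V, if τ v then lam v else 1 := fun τ =>
    Finset.prod_pos fun v _ => by split_ifs <;> [exact hl v; norm_num]
  have hn : ∀ τ : Conf V, 0 ≤ μ τ * ∏ v : V, if τ v then lam v else 1 := fun τ =>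
    mul_nonneg (hμ.1 τ) (hpr τ).le
  have hD0 : 0 < D := by
    refine (Finset.sum_nonneg fun τ _ => hn τ).lt_of_ne fun h0 => ?_
    have h1 := (Finset.sum_eq_zero_iff_of_nonneg fun τ _ => hn τ).1 h0.symm
    have h2 : ∑ a, μ a = 0 := Finset.sum_eq_zero fun τ ht =>
      (mul_eq_zero.1 (h1 τ ht)).resolve_right (hpr τ).ne'
    rw [hμ.2] at h2; norm_num at h2
  have hd : IsDist (magnetize μ lam) := by
    refine ⟨fun σ => div_nonneg (hn σ) hD0.le, ?_⟩
    unfold magnetize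
    rw [← Finset.sum_div]; exact div_self hD0.ne'
  have := good_smul (good_of_SI _ hd (h lam hl)) D
  convert this using 2 with σ
  unfold magnetize
  rw [mul_div_cancel₀ _ hD0.ne']

def eqv : Conf (V × Fin 1) ≃ Conf V where
  toFun τ v := τ (v, 0)
  invFun σ p := σ p.1
  left_inv τ := by
    funext ⟨v, i⟩
    have : i = 0 := Subsingleton.elim _ _
    subst this; rfl
  right_inv σ := rfl

lemma ktrans_one (μ : Conf V → ℝ) (τ : Conf (V × Fin 1)) : ktrans μ 1 τ = μ (eqv τ) := by
  unfold ktrans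
  rw [if_pos]
  · have : kstar τ = eqv τ := by
      funext v
      simp [kstar, eqv, Fin.exists_fin_one]
    simp [this]
  · intro v
    exact (Finset.card_le_univ _).trans (by simp)

lemma sum_eqv (F : Conf V → ℝ) : ∑ τ : Conf (V × Fin 1), F (eqv τ) = ∑ σ, F σ :=
  Equiv.sum_comp eqv F

lemma good_all {η : ℝ} (μ : Conf V → ℝ) (hμ : IsDist μ) (h : SIinfAllFields (ktrans μ 1) η)
    (lam : V → ℝ) (hl : ∀ v, 0 < lam v) :
    Good (1 + η) (fun σ => μ σ * ∏ v : V, if σ v then lam v else 1) := by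
  have hk : IsDist (ktrans μ 1) := by
    refine ⟨fun τ => by rw [ktrans_one]; exact hμ.1 _, ?_⟩
    simp only [ktrans_one]
    rw [sum_eqv (fun σ => μ σ)]; exact hμ.2
  have hg := good_of_SIall _ hk h (fun p => lam p.1) (fun p => hl _)
  intro x
  have := hg (fun p => x p.1)
  simp only [ktrans_one, Fintype.sum_prod_type, Fintype.prod_prod_type, Fin.sum_univ_one,
    Fin.prod_univ_one, Finset.univ_unique, Finset.sum_singleton, Finset.prod_singleton] at this
  have h1 := sum_eqv (V := V) (fun σ => (μ σ * ∏ v : V, if σ v then lam v else 1) * (∑ v, x v * XX (σ v)) ^ 2)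
  have h2 := sum_eqv (V := V) (fun σ => (μ σ * ∏ v : V, if σ v then lam v else 1) * (∑ v, x v * XX (σ v)))
  have h3 := sum_eqv (V := V) (fun σ => (μ σ * ∏ v : V, if σ v then lam v else 1))
  have h4 := fun v => sum_eqv (V := V) (fun σ => (μ σ * ∏ v : V, if σ v then lam v else 1) * XX (σ v))
  simp only [← h1, ← h2, ← h3, ← h4]
  exact this

lemma good_R {κ : ℝ} (μ : Conf V → ℝ)
    (h : ∀ lam : V → ℝ, (∀ v, 0 < lam v) →
      Good κ (fun σ => μ σ * ∏ v : V, if σ v then lam v else 1))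
    (R : Finset V) (lam : V → ℝ) (hl : ∀ v, 0 < lam v) :
    Good κ (fun σ => if ∀ v ∈ R, σ v = true then
      μ σ * ∏ v : V, (if σ v then lam v else 1) else 0) := by
  set w : ℝ → Conf V → ℝ := fun ε σ =>
    (μ σ * ∏ v : V, (if σ v then lam v else 1)) * ∏ v ∈ R, (if σ v then 1 else ε) with hw
  have hpos : ∀ ε > 0, Good κ (w ε) := by
    intro ε hε
    have := good_smul (h (fun v => if v ∈ R then lam v / ε else lam v)
      (fun v => by split_ifs <;> [exact div_pos (hl v) hε; exact hl v])) (∏ v ∈ R, ε)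
    convert this using 2 with σ
    rw [hw]
    have e : (∏ v ∈ R, (if σ v then 1 else ε)) = ∏ v, (if v ∈ R then (if σ v then 1 else ε) else 1) := by
      rw [Finset.prod_ite_mem]; simp
    have e' : (∏ v ∈ R, ε) = ∏ v, (if v ∈ R then ε else 1) := by
      rw [Finset.prod_ite_mem]; simp
    simp only
    rw [e, e', mul_left_comm, mul_assoc, ← Finset.prod_mul_distrib, ← Finset.prod_mul_distrib]
    congr 1
    refine Finset.prod_congr rfl fun v _ => ?_
    split_ifs <;> field_simp
  have h0 : w 0 = (fun σ => if ∀ v ∈ R, σ v = true then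
      μ σ * ∏ v : V, (if σ v then lam v else 1) else 0) := by
    funext σ
    rw [hw]
    simp only
    split_ifs with hh
    · have : (∏ v ∈ R, (if σ v = true then (1:ℝ) else 0)) = 1 :=
        Finset.prod_eq_one fun v hv => by simp [hh v hv]
      rw [this, mul_one]
    · push Not at hh
      obtain ⟨v, hv, hv'⟩ := hh
      rw [Finset.prod_eq_zero hv (by simp [hv']), mul_zero]
  rw [← h0]
  intro x
  have hwc : ∀ σ, Continuous fun ε => w ε σ := by
    intro σ
    refine continuous_const.mul (continuous_finsetProd (f := fun v (ε : ℝ) => (if σ v = true then (1:ℝ) else ε)) _ fun v _ => ?_)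
    by_cases hh : σ v = true
    · simp only [hh, if_true]; exact continuous_const
    · simp only [hh, if_false]; exact continuous_id
  have c1 : Continuous fun ε => (∑ σ, w ε σ * (∑ v, x v * XX (σ v)) ^ 2) * (∑ σ, w ε σ)
      - (∑ σ, w ε σ * ∑ v, x v * XX (σ v)) ^ 2 := by fun_prop
  have c2 : Continuous fun ε => κ * (∑ v, x v ^ 2 * ∑ σ, w ε σ * XX (σ v)) * ∑ σ, w ε σ := by
    fun_prop
  refine le_of_tendsto_of_tendsto (b := nhdsWithin (0:ℝ) (Set.Ioi 0))
    ((c1.tendsto 0).mono_left nhdsWithin_le_nhds)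
    ((c2.tendsto 0).mono_left nhdsWithin_le_nhds) ?_
  filter_upwards [self_mem_nhdsWithin] with ε hε
  exact hpos ε hε x

lemma TI {κ : ℝ} (hκ : 0 < κ) (w : Conf V → ℝ) (hw : ∀ σ, 0 ≤ w σ) (hA : 0 < ∑ σ, w σ)
    (h : ∀ lam : V → ℝ, (∀ v, 0 < lam v) →
      Good κ (fun σ => w σ * ∏ v : V, if σ v then lam v else 1))
    (z : V → ℝ) (hz : ∀ v, 0 < z v) :
    ∑ σ, w σ * Real.exp (κ⁻¹ * ∑ v, XX (σ v) * Real.log (z v)) ≤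
      (∑ σ, w σ) * Real.exp (κ⁻¹ * ∑ v, (∑ σ, w σ * XX (σ v)) / (∑ σ, w σ) * (z v - 1)) := by
  set s := κ⁻¹ with hs
  have hs0 : 0 < s := inv_pos.2 hκ
  set y : V → ℝ → ℝ := fun v t => 1 + t * (z v - 1) with hy
  have hy0 : ∀ v, ∀ t ∈ Set.Icc (0:ℝ) 1, 0 < y v t := by
    intro v t ht
    have := hz v
    simp only [hy]
    rcases ht.1.eq_or_lt with h0 | h0
    · rw [← h0]; norm_num
    · nlinarith [ht.2, mul_pos h0 this]
  set H : Conf V → ℝ → ℝ := fun σ t => s * ∑ v, XX (σ v) * Real.log (y v t) with hH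
  set H1 : Conf V → ℝ → ℝ := fun σ t => s * ∑ v, XX (σ v) * ((z v - 1) / y v t) with hH1
  set H2 : Conf V → ℝ → ℝ := fun σ t => s * ∑ v, XX (σ v) * (-((z v - 1) / y v t) ^ 2) with hH2
  have dy : ∀ v t, HasDerivAt (y v) (z v - 1) t := by
    intro v t
    have := ((hasDerivAt_id t).mul_const (z v - 1)).const_add 1
    rw [one_mul] at this
    exact this
  have dH : ∀ σ, ∀ t ∈ Set.Icc (0:ℝ) 1, HasDerivAt (H σ) (H1 σ t) t := by
    intro σ t ht
    refine HasDerivAt.const_mul s (HasDerivAt.fun_sum fun v _ => ?_)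
    exact ((dy v t).log (hy0 v t ht).ne').const_mul _
  have dH1 : ∀ σ, ∀ t ∈ Set.Icc (0:ℝ) 1, HasDerivAt (H1 σ) (H2 σ t) t := by
    intro σ t ht
    refine HasDerivAt.const_mul s (HasDerivAt.fun_sum fun v _ => HasDerivAt.const_mul _ ?_)
    have h1 := (hasDerivAt_const t (z v - 1)).div (dy v t) (hy0 v t ht).ne'
    have h2 : -((z v - 1) / y v t) ^ 2 = (0 * y v t - (z v - 1) * (z v - 1)) / y v t ^ 2 := by
      rw [div_pow]; ring
    rw [h2]
    exact h1
  set g : ℝ → ℝ := fun t => ∑ σ, w σ * Real.exp (H σ t) with hg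
  set g1 : ℝ → ℝ := fun t => ∑ σ, w σ * (Real.exp (H σ t) * H1 σ t) with hg1
  set g2 : ℝ → ℝ := fun t => ∑ σ, w σ *
    (Real.exp (H σ t) * H1 σ t * H1 σ t + Real.exp (H σ t) * H2 σ t) with hg2
  have dg : ∀ t ∈ Set.Icc (0:ℝ) 1, HasDerivAt g (g1 t) t := fun t ht =>
    HasDerivAt.fun_sum fun σ _ => ((dH σ t ht).exp).const_mul _
  have dg1 : ∀ t ∈ Set.Icc (0:ℝ) 1, HasDerivAt g1 (g2 t) t := fun t ht =>
    HasDerivAt.fun_sum fun σ _ => (((dH σ t ht).exp).mul (dH1 σ t ht)).const_mul _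
  have gpos : ∀ t, 0 < g t := by
    intro t
    refine (Finset.sum_nonneg fun σ _ => mul_nonneg (hw σ) (Real.exp_pos _).le).lt_of_ne fun h0 => ?_
    have h1 := (Finset.sum_eq_zero_iff_of_nonneg fun σ _ =>
      mul_nonneg (hw σ) (Real.exp_pos (H σ t)).le).1 h0.symm
    have h2 : ∑ a, w a = 0 := Finset.sum_eq_zero fun τ ht =>
      (mul_eq_zero.1 (h1 τ ht)).resolve_right (Real.exp_pos _).ne'
    linarith
  have key : ∀ t ∈ Set.Icc (0:ℝ) 1, g2 t * g t - g1 t * g1 t ≤ 0 := by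
    intro t ht
    have hG := h (fun v => Real.exp (s * Real.log (y v t))) (fun v => Real.exp_pos _)
      (fun v => (z v - 1) / y v t)
    have e0 : ∀ σ : Conf V, (∏ v : V, if σ v then Real.exp (s * Real.log (y v t)) else 1)
        = Real.exp (H σ t) := by
      intro σ
      rw [hH]; simp only
      rw [Finset.mul_sum, Real.exp_sum]
      refine Finset.prod_congr rfl fun v _ => ?_
      cases σ v <;> simp [XX]
    simp only [e0] at hG
    set x : V → ℝ := fun v => (z v - 1) / y v t with hx
    have e1 : g1 t = s * ∑ σ, w σ * Real.exp (H σ t) * ∑ v, x v * XX (σ v) := by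
      rw [hg1]; simp only [hH1, Finset.mul_sum]
      exact Finset.sum_congr rfl fun σ _ => Finset.sum_congr rfl fun v _ => by ring
    have e2 : g2 t = s ^ 2 * (∑ σ, w σ * Real.exp (H σ t) * (∑ v, x v * XX (σ v)) ^ 2)
        - s * (∑ v, x v ^ 2 * ∑ σ, w σ * Real.exp (H σ t) * XX (σ v)) := by
      have e3 : (∑ v, x v ^ 2 * ∑ σ, w σ * Real.exp (H σ t) * XX (σ v))
          = ∑ σ, w σ * Real.exp (H σ t) * ∑ v, XX (σ v) * x v ^ 2 := by
        simp only [Finset.mul_sum]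
        rw [Finset.sum_comm]
        exact Finset.sum_congr rfl fun σ _ => Finset.sum_congr rfl fun v _ => by ring
      rw [e3, Finset.mul_sum, Finset.mul_sum, ← Finset.sum_sub_distrib, hg2]
      refine Finset.sum_congr rfl fun σ _ => ?_
      have e4 : H1 σ t = s * ∑ v, x v * XX (σ v) := by
        rw [hH1]; simp only; congr 1
        exact Finset.sum_congr rfl fun v _ => by ring
      have e5 : H2 σ t = - (s * ∑ v, XX (σ v) * x v ^ 2) := by
        rw [hH2]; simp only [mul_neg, Finset.sum_neg_distrib, hx]
      rw [e4, e5]; ring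
    have h3 := mul_le_mul_of_nonneg_left hG (sq_nonneg s)
    have h4 : s ^ 2 * κ = s := by rw [hs]; field_simp
    rw [e1, e2]
    have e6 : g t = ∑ σ, w σ * Real.exp (H σ t) := rfl
    rw [e6]
    set a1 := ∑ σ, w σ * Real.exp (H σ t) * (∑ v, x v * XX (σ v)) ^ 2
    set a2 := ∑ v, x v ^ 2 * ∑ σ, w σ * Real.exp (H σ t) * XX (σ v)
    set a3 := ∑ σ, w σ * Real.exp (H σ t)
    set a4 := ∑ σ, w σ * Real.exp (H σ t) * ∑ v, x v * XX (σ v)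
    have h5 : s ^ 2 * (κ * a2 * a3) = s * a2 * a3 := by
      linear_combination a2 * a3 * h4
    nlinarith
  have dq : ∀ t ∈ Set.Icc (0:ℝ) 1,
      HasDerivAt (fun t => g1 t / g t) ((g2 t * g t - g1 t * g1 t) / g t ^ 2) t :=
    fun t ht => (dg1 t ht).div (dg t ht) (gpos t).ne'
  have hanti : AntitoneOn (fun t => g1 t / g t) (Set.Icc 0 1) := by
    refine antitoneOn_of_deriv_nonpos (convex_Icc 0 1)
      (fun t ht => (dq t ht).continuousAt.continuousWithinAt)
      (fun t ht => (dq t (interior_subset ht)).differentiableAt.differentiableWithinAt) ?_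
    intro t ht
    rw [(dq t (interior_subset ht)).deriv]
    exact div_nonpos_of_nonpos_of_nonneg (key t (interior_subset ht)) (sq_nonneg _)
  set c := g1 0 / g 0 with hc
  have dl : ∀ t ∈ Set.Icc (0:ℝ) 1,
      HasDerivAt (fun t => Real.log (g t) - t * c) (g1 t / g t - 1 * c) t :=
    fun t ht => ((dg t ht).log (gpos t).ne').sub ((hasDerivAt_id t).mul_const c)
  have hanti2 : AntitoneOn (fun t => Real.log (g t) - t * c) (Set.Icc 0 1) := by
    refine antitoneOn_of_deriv_nonpos (convex_Icc 0 1)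
      (fun t ht => (dl t ht).continuousAt.continuousWithinAt)
      (fun t ht => (dl t (interior_subset ht)).differentiableAt.differentiableWithinAt) ?_
    intro t ht
    have ht' := interior_subset ht
    rw [(dl t ht').deriv]
    have := hanti (by simp : (0:ℝ) ∈ Set.Icc (0:ℝ) 1) ht' ht'.1
    simp only at this
    linarith
  have hfin := hanti2 (by simp : (0:ℝ) ∈ Set.Icc (0:ℝ) 1) (by simp : (1:ℝ) ∈ Set.Icc (0:ℝ) 1)
    zero_le_one
  simp only [one_mul, zero_mul, sub_zero] at hfin
  have g0 : g 0 = ∑ σ, w σ := by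
    simp [hg, hH, hy]
  have gg1 : g 1 = ∑ σ, w σ * Real.exp (s * ∑ v, XX (σ v) * Real.log (z v)) := by
    simp [hg, hH, hy]
  have hc' : c = s * ∑ v, (∑ σ, w σ * XX (σ v)) / (∑ σ, w σ) * (z v - 1) := by
    rw [hc, g0]
    have : g1 0 = s * ∑ v, (∑ σ, w σ * XX (σ v)) * (z v - 1) := by
      simp only [hg1, hH, hy, hH1]
      simp only [zero_mul, add_zero, Real.log_one, mul_zero, Finset.sum_const_zero, Real.exp_zero,
        one_mul, div_one, Finset.mul_sum, Finset.sum_mul]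
      rw [Finset.sum_comm]
      exact Finset.sum_congr rfl fun σ _ => Finset.sum_congr rfl fun v _ => by ring
    rw [this, mul_div_assoc, Finset.sum_div]
    congr 1
    exact Finset.sum_congr rfl fun v _ => by ring
  rw [← gg1, ← hc', ← g0]
  have : Real.log (g 1) ≤ Real.log (g 0) + c := by linarith
  calc g 1 = Real.exp (Real.log (g 1)) := (Real.exp_log (gpos 1)).symm
    _ ≤ Real.exp (Real.log (g 0) + c) := Real.exp_le_exp.2 this
    _ = _ := by rw [Real.exp_add, Real.exp_log (gpos 0)]

lemma flogf {f y : ℝ} (hf : 0 < f) (hy : 0 < y) :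
    f * Real.log y + f - y ≤ f * Real.log f := by
  have h1 := Real.log_le_sub_one_of_pos (div_pos hy hf)
  rw [Real.log_div hy.ne' hf.ne'] at h1
  have h2 := mul_le_mul_of_nonneg_left h1 hf.le
  have h3 : f * (y / f - 1) = y - f := by field_simp
  linarith

/-- entropic independence -/
lemma EI {κ : ℝ} (hκ : 0 < κ) (w : Conf V → ℝ) (hw : ∀ σ, 0 ≤ w σ) (hA : 0 < ∑ σ, w σ)
    (h : ∀ lam : V → ℝ, (∀ v, 0 < lam v) →
      Good κ (fun σ => w σ * ∏ v : V, if σ v then lam v else 1))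
    (f : Conf V → ℝ) (hf : ∀ σ, 0 < f σ) (A B : ℝ) (a b : V → ℝ)
    (hAd : A = ∑ σ, w σ) (hBd : B = ∑ σ, w σ * f σ)
    (had : ∀ v, a v = ∑ σ, w σ * XX (σ v)) (hbd : ∀ v, b v = ∑ σ, w σ * f σ * XX (σ v)) :
    ∑ v, (b v * Real.log (b v / a v) - b v * Real.log (B / A) - b v + B * a v / A)
      ≤ κ * ((∑ σ, w σ * (f σ * Real.log (f σ))) - B * Real.log (B / A)) := by
  have hA' : 0 < A := hAd ▸ hA
  have hposF : ∀ (u : Conf V → ℝ), (∀ σ, 0 ≤ u σ) →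
      ((∑ σ, u σ) ≠ 0 → 0 < ∑ σ, u σ * f σ) := by
    intro u hu hne
    refine (Finset.sum_nonneg fun σ _ => mul_nonneg (hu σ) (hf σ).le).lt_of_ne fun h0 => hne ?_
    have h1 := (Finset.sum_eq_zero_iff_of_nonneg fun σ _ =>
      mul_nonneg (hu σ) (hf σ).le).1 h0.symm
    exact Finset.sum_eq_zero fun τ ht => (mul_eq_zero.1 (h1 τ ht)).resolve_right (hf τ).ne'
  have hB : 0 < B := by rw [hBd]; exact hposF w hw hA.ne'
  have hwX : ∀ v σ, 0 ≤ w σ * XX (σ v) := fun v σ => mul_nonneg (hw σ) (XX_nonneg _)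
  have hb : ∀ v, a v ≠ 0 → 0 < b v := by
    intro v hv
    have := hposF (fun σ => w σ * XX (σ v)) (hwX v) (by rw [← had]; exact hv)
    rw [hbd]
    refine this.trans_eq (Finset.sum_congr rfl fun σ _ => by ring)
  have ha : ∀ v, 0 ≤ a v := fun v => by rw [had]; exact Finset.sum_nonneg fun σ _ => hwX v σ
  have hb0 : ∀ v, a v = 0 → b v = 0 := by
    intro v hv
    rw [had] at hv
    have h1 := (Finset.sum_eq_zero_iff_of_nonneg fun σ _ => hwX v σ).1 hv
    rw [hbd]
    refine Finset.sum_eq_zero fun σ hσ => ?_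
    have := h1 σ hσ
    linear_combination f σ * this
  set z : V → ℝ := fun v => if a v = 0 then 1 else (b v / a v) / (B / A) with hz
  have hz0 : ∀ v, 0 < z v := by
    intro v
    simp only [hz]
    split_ifs with h0
    · exact one_pos
    · exact div_pos (div_pos (hb v h0) ((ha v).lt_of_ne' h0)) (div_pos hB hA')
  have ti := TI hκ w hw hA h z hz0
  rw [← hAd] at ti
  simp only [← had] at ti
  set s := κ⁻¹ with hs
  set d := s * ∑ v, a v / A * (z v - 1) with hd
  have hpt : ∀ σ, w σ * (f σ * (Real.log (B / A) - d + s * ∑ v, XX (σ v) * Real.log (z v)) + f σ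
      - (B / A * Real.exp (-d)) * Real.exp (s * ∑ v, XX (σ v) * Real.log (z v)))
      ≤ w σ * (f σ * Real.log (f σ)) := by
    intro σ
    refine mul_le_mul_of_nonneg_left ?_ (hw σ)
    have hyp : 0 < (B / A * Real.exp (-d)) * Real.exp (s * ∑ v, XX (σ v) * Real.log (z v)) := by
      have := div_pos hB hA'
      positivity
    have := flogf (hf σ) hyp
    rw [Real.log_mul (by have := div_pos hB hA'; positivity) (Real.exp_pos _).ne',
      Real.log_mul (div_pos hB hA').ne' (Real.exp_pos _).ne', Real.log_exp, Real.log_exp] at this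
    linarith
  have hsum := Finset.sum_le_sum fun σ (_ : σ ∈ Finset.univ) => hpt σ
  have e1 : (∑ σ, w σ * (f σ * (Real.log (B / A) - d + s * ∑ v, XX (σ v) * Real.log (z v)) + f σ
      - (B / A * Real.exp (-d)) * Real.exp (s * ∑ v, XX (σ v) * Real.log (z v))))
      = B * (Real.log (B / A) - d) + s * (∑ v, b v * Real.log (z v)) + B
        - (B / A * Real.exp (-d)) * ∑ σ, w σ * Real.exp (s * ∑ v, XX (σ v) * Real.log (z v)) := by
    have e2 : (∑ v, b v * Real.log (z v)) = ∑ σ, w σ * f σ * ∑ v, XX (σ v) * Real.log (z v) := by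
      simp only [hbd, Finset.mul_sum, Finset.sum_mul]
      rw [Finset.sum_comm]
      exact Finset.sum_congr rfl fun σ _ => Finset.sum_congr rfl fun v _ => by ring
    rw [e2, hBd, Finset.sum_mul, Finset.mul_sum, Finset.mul_sum, ← Finset.sum_add_distrib,
      ← Finset.sum_add_distrib, ← Finset.sum_sub_distrib]
    exact Finset.sum_congr rfl fun σ _ => by ring
  rw [e1] at hsum
  have h2 : (B / A * Real.exp (-d)) * (∑ σ, w σ * Real.exp (s * ∑ v, XX (σ v) * Real.log (z v)))
      ≤ B := by
    have := mul_le_mul_of_nonneg_left ti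
      (mul_nonneg (div_pos hB hA').le (Real.exp_pos (-d)).le)
    refine this.trans_eq ?_
    rw [Real.exp_neg]
    have := (Real.exp_pos d).ne'
    field_simp
  have e3 : ∑ v, (b v * Real.log (b v / a v) - b v * Real.log (B / A) - b v + B * a v / A)
      = ∑ v, b v * Real.log (z v) - B * ∑ v, a v / A * (z v - 1) := by
    rw [Finset.mul_sum, ← Finset.sum_sub_distrib]
    refine Finset.sum_congr rfl fun v _ => ?_
    by_cases h0 : a v = 0
    · simp [h0, hb0 v h0]
    · have hav := (ha v).lt_of_ne' h0
      have hbv := hb v h0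
      simp only [hz, if_neg h0]
      rw [Real.log_div (div_pos hbv hav).ne' (div_pos hB hA').ne']
      field_simp
      ring
  rw [e3]
  have h4 : s * (∑ v, b v * Real.log (z v) - B * ∑ v, a v / A * (z v - 1)) ≤
    (∑ σ, w σ * (f σ * Real.log (f σ))) - B * Real.log (B / A) := by
    have : s * (∑ v, b v * Real.log (z v) - B * ∑ v, a v / A * (z v - 1))
      = s * (∑ v, b v * Real.log (z v)) - B * d := by rw [hd]; ring
    rw [this]; linarith
  have h5 := mul_le_mul_of_nonneg_left h4 hκ.le
  rwa [hs, ← mul_assoc, mul_inv_cancel₀ hκ.ne', one_mul] at h5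

def SS (g : Conf V → ℝ) (R : Finset V) (t : ℝ) : ℝ :=
  ∑ σ : Conf V, if ∀ v ∈ R, σ v = true then g σ * t ^ plusCount σ else 0

lemma ite_insert (σ : Conf V) (R : Finset V) (u : V) (c : ℝ) :
    (if ∀ v ∈ insert u R, σ v = true then c else 0)
      = (if ∀ v ∈ R, σ v = true then c else 0) * XX (σ u) := by
  simp only [Finset.forall_mem_insert]
  cases h : σ u <;> simp [XX]

lemma sum_XX (σ : Conf V) : ∑ v, XX (σ v) = (plusCount σ : ℝ) := by
  unfold XX plusCount plusSet
  rw [Finset.sum_boole]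

lemma sum_SS_insert (g : Conf V → ℝ) (R : Finset V) (t : ℝ) :
    ∑ u, SS g (insert u R) t = ∑ σ : Conf V,
      (if ∀ v ∈ R, σ v = true then g σ * t ^ plusCount σ else 0) * plusCount σ := by
  unfold SS
  simp only [ite_insert]
  rw [Finset.sum_comm]
  refine Finset.sum_congr rfl fun σ _ => ?_
  rw [← Finset.mul_sum, sum_XX]

lemma dSS (g : Conf V → ℝ) (R : Finset V) {t : ℝ} (ht : t ≠ 0) :
    HasDerivAt (SS g R) ((∑ u, SS g (insert u R) t) / t) t := by
  rw [sum_SS_insert, Finset.sum_div]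
  refine HasDerivAt.fun_sum fun σ _ => ?_
  split_ifs with h
  · have h1 := (hasDerivAt_pow (plusCount σ) t).const_mul (g σ)
    refine h1.congr_deriv (Eq.symm ?_)
    rcases Nat.eq_zero_or_pos (plusCount σ) with h0 | h0
    · simp [h0]
    · obtain ⟨n, hn⟩ := Nat.exists_eq_succ_of_ne_zero h0.ne'
      rw [hn]
      simp only [Nat.succ_eq_add_one, Nat.add_sub_cancel]
      field_simp
      ring
  · simpa using hasDerivAt_const t (0:ℝ)

lemma SS_nonneg (g : Conf V → ℝ) (hg : ∀ σ, 0 ≤ g σ) (R : Finset V) {t : ℝ} (ht : 0 < t) :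
    0 ≤ SS g R t := by
  refine Finset.sum_nonneg fun σ _ => ?_
  split_ifs
  · exact mul_nonneg (hg σ) (pow_pos ht _).le
  · exact le_rfl

lemma SS_zero (μ : Conf V → ℝ) (hg : ∀ σ, 0 ≤ μ σ) (R : Finset V) {t : ℝ} (ht : 0 < t)
    (h : SS μ R t = 0) : ∀ σ : Conf V, (∀ v ∈ R, σ v = true) → μ σ = 0 := by
  intro σ hσ
  have h1 := (Finset.sum_eq_zero_iff_of_nonneg (fun σ _ => by
    split_ifs
    · exact mul_nonneg (hg σ) (pow_pos ht _).le
    · exact le_rfl)).1 h σ (Finset.mem_univ _)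
  rw [if_pos hσ] at h1
  exact (mul_eq_zero.1 h1).resolve_right (pow_pos ht _).ne'

lemma SS_eq_zero (μ : Conf V → ℝ) (R : Finset V)
    (h : ∀ σ : Conf V, (∀ v ∈ R, σ v = true) → μ σ = 0) (t : ℝ) : SS μ R t = 0 :=
  Finset.sum_eq_zero fun σ _ => by
    split_ifs with h1
    · rw [h σ h1, zero_mul]
    · rfl

lemma SS_pos (μ : Conf V → ℝ) (hμ : ∀ σ, 0 ≤ μ σ) (f : Conf V → ℝ) (hf : ∀ σ, 0 < f σ)
    (R : Finset V) {t t' : ℝ} (ht : 0 < t) (ht' : 0 < t')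
    (h : 0 < SS μ R t) : 0 < SS (fun σ => μ σ * f σ) R t' := by
  have hn : ∀ σ, 0 ≤ μ σ * f σ := fun σ => mul_nonneg (hμ σ) (hf σ).le
  refine (SS_nonneg _ hn R ht').lt_of_ne' fun h0 => h.ne' ?_
  have := SS_zero _ hn R ht' h0
  exact SS_eq_zero _ _ (fun σ hσ => (mul_eq_zero.1 (this σ hσ)).resolve_right (hf σ).ne') _

lemma binom_SS (g : Conf V → ℝ) {t : ℝ} (ht : t ≠ 0) :
    ∑ R : Finset V, ((1 - t) / t) ^ R.card * SS g R t = ∑ σ, g σ := by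
  unfold SS
  simp only [Finset.mul_sum]
  rw [Finset.sum_comm]
  refine Finset.sum_congr rfl fun σ _ => ?_
  have e : ∀ R : Finset V, (∀ v ∈ R, σ v = true) ↔ R ∈ (plusSet σ).powerset := by
    intro R
    rw [Finset.mem_powerset, Finset.subset_iff]
    simp [plusSet]
  simp only [e, mul_ite, mul_zero]
  rw [Finset.sum_ite_mem, Finset.univ_inter, ← Finset.sum_mul]
  have h1 := Finset.sum_pow_mul_eq_add_pow ((1 - t) / t) 1 (plusSet σ)
  simp only [one_pow, mul_one] at h1
  rw [h1]
  have : (1 - t) / t + 1 = t⁻¹ := by field_simp; ring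
  rw [this]
  unfold plusCount
  rw [inv_pow]
  field_simp

lemma reindex (F : Finset V → ℝ) (r : ℝ) :
    ∑ R : Finset V, (R.card : ℝ) * r ^ (R.card - 1) * F R
      = ∑ R : Finset V, r ^ R.card * ∑ v ∈ Rᶜ, F (insert v R) := by
  have e1 : ∀ R : Finset V, (R.card : ℝ) * r ^ (R.card - 1) * F R
      = ∑ v, if v ∈ R then r ^ (R.card - 1) * F R else 0 := by
    intro R
    rw [Finset.sum_ite_mem, Finset.univ_inter, Finset.sum_const, nsmul_eq_mul]; ring
  have e2 : ∀ R : Finset V, r ^ R.card * ∑ v ∈ Rᶜ, F (insert v R)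
      = ∑ v, if v ∉ R then r ^ R.card * F (insert v R) else 0 := by
    intro R
    rw [Finset.mul_sum, ← Finset.sum_filter]
    refine Finset.sum_congr ?_ fun _ _ => rfl
    ext v; simp
  simp only [e1, e2]
  rw [Finset.sum_comm, Finset.sum_comm (γ := Finset V) (α := V)]
  refine Finset.sum_congr rfl fun v _ => ?_
  rw [← Finset.sum_filter, ← Finset.sum_filter]
  refine Finset.sum_bij' (fun R _ => R.erase v) (fun R _ => insert v R) ?_ ?_ ?_ ?_ ?_
  · intro R hR; simp
  · intro R hR; simp
  · intro R hR
    exact Finset.insert_erase (Finset.mem_filter.1 hR).2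
  · intro R hR
    exact Finset.erase_insert (Finset.mem_filter.1 hR).2
  · intro R hR
    have := (Finset.mem_filter.1 hR).2
    rw [Finset.insert_erase this, Finset.card_erase_of_mem this]

lemma reindex2 (F : Finset V → ℝ) {t : ℝ} (ht : t ≠ 0) :
    (∑ R : Finset V, (R.card : ℝ) * ((1 - t) / t) ^ (R.card - 1) * F R) / t
      = ∑ R : Finset V, ((1 - t) / t) ^ R.card * ∑ v, F (insert v R) := by
  set r := (1 - t) / t with hr
  have h1 : ∀ R : Finset V, ∑ v, F (insert v R) = R.card * F R + ∑ v ∈ Rᶜ, F (insert v R) := by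
    intro R
    rw [← Finset.sum_add_sum_compl R]
    congr 1
    rw [Finset.sum_congr rfl (g := fun _ => F R) (fun v hv => by rw [Finset.insert_eq_of_mem hv])]
    simp
  simp only [h1, mul_add, Finset.sum_add_distrib]
  rw [← reindex F r]
  have h2 : 1 / t = r + 1 := by rw [hr]; field_simp; ring
  rw [div_eq_mul_one_div, h2, mul_add, mul_one]
  congr 1
  rw [Finset.sum_mul]
  refine Finset.sum_congr rfl fun R _ => ?_
  rcases Nat.eq_zero_or_pos R.card with h0 | h0
  · simp [h0]
  · obtain ⟨n, hn⟩ := Nat.exists_eq_succ_of_ne_zero h0.ne'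
    rw [hn]
    simp only [Nat.succ_eq_add_one, Nat.add_sub_cancel]
    ring

section main
variable (μ f : Conf V → ℝ)

def aa (R : Finset V) (t : ℝ) : ℝ := SS μ R t
def bb (R : Finset V) (t : ℝ) : ℝ := SS (fun σ => μ σ * f σ) R t
def phi (R : Finset V) (t : ℝ) : ℝ := bb μ f R t * Real.log (bb μ f R t / aa μ R t)
def kk (R : Finset V) (t : ℝ) : ℝ := SS (fun σ => μ σ * (f σ * Real.log (f σ))) R t
def TT (R : Finset V) (t : ℝ) : ℝ :=
  ∑ v, (bb μ f (insert v R) t * Real.log (bb μ f R t / aa μ R t) + bb μ f (insert v R) t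
    - bb μ f R t * aa μ (insert v R) t / aa μ R t)
def EE (t : ℝ) : ℝ :=
  ∑ R : Finset V, ((1 - t) / t) ^ R.card * (kk μ f R t - phi μ f R t)

variable {μ f}

lemma zero_all (hμ : ∀ σ, 0 ≤ μ σ) {R : Finset V} {t : ℝ} (ht : 0 < t) (h : aa μ R t = 0)
    (t' : ℝ) : aa μ R t' = 0 ∧ bb μ f R t' = 0 ∧ kk μ f R t' = 0 ∧
      (∀ v, aa μ (insert v R) t' = 0 ∧ bb μ f (insert v R) t' = 0) := by
  have h0 := SS_zero μ hμ R ht h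
  have h1 : ∀ v, ∀ σ : Conf V, (∀ u ∈ insert v R, σ u = true) → μ σ = 0 := fun v σ hσ =>
    h0 σ fun u hu => hσ u (Finset.mem_insert_of_mem hu)
  refine ⟨SS_eq_zero _ _ h0 _, SS_eq_zero _ _ (fun σ hσ => by rw [h0 σ hσ, zero_mul]) _,
    SS_eq_zero _ _ (fun σ hσ => by rw [h0 σ hσ, zero_mul]) _, fun v => ⟨SS_eq_zero _ _ (h1 v) _,
    SS_eq_zero _ _ (fun σ hσ => by rw [h1 v σ hσ, zero_mul]) _⟩⟩

lemma dphi (hμ : ∀ σ, 0 ≤ μ σ) (hf : ∀ σ, 0 < f σ) (R : Finset V) {t : ℝ} (ht : 0 < t) :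
    HasDerivAt (phi μ f R) (TT μ f R t / t) t := by
  by_cases h : aa μ R t = 0
  · have hz := zero_all (f := f) hμ ht h
    have h1 : phi μ f R = fun _ => 0 := by
      funext t'; simp [phi, (hz t').2.1]
    have h2 : TT μ f R t = 0 := by
      unfold TT
      refine Finset.sum_eq_zero fun v _ => ?_
      simp [(hz t).2.1, ((hz t).2.2.2 v).2]
    rw [h1, h2, zero_div]; exact hasDerivAt_const _ _
  · have ha : 0 < aa μ R t := (SS_nonneg μ hμ R ht).lt_of_ne' h
    have hb : 0 < bb μ f R t := SS_pos μ hμ f hf R ht ht ha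
    have da : HasDerivAt (aa μ R) ((∑ u, aa μ (insert u R) t) / t) t := dSS μ R ht.ne'
    have db : HasDerivAt (bb μ f R) ((∑ u, bb μ f (insert u R) t) / t) t := dSS _ R ht.ne'
    have h1 := db.mul ((db.div da ha.ne').log (div_pos hb ha).ne')
    refine h1.congr_deriv (Eq.symm ?_)
    unfold TT
    simp only [Finset.sum_add_distrib, Finset.sum_sub_distrib, ← Finset.sum_mul, ← Finset.sum_div,
      ← Finset.mul_sum, Pi.div_apply]
    field_simp
    ring

lemma E_eq (t : ℝ) (ht : t ≠ 0) : EE μ f t = (∑ σ, μ σ * (f σ * Real.log (f σ)))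
    - ∑ R : Finset V, ((1 - t) / t) ^ R.card * phi μ f R t := by
  unfold EE
  simp only [mul_sub, Finset.sum_sub_distrib]
  congr 1
  exact binom_SS _ ht

lemma dE (hμ : ∀ σ, 0 ≤ μ σ) (hf : ∀ σ, 0 < f σ) {t : ℝ} (ht : 0 < t) :
    HasDerivAt (EE μ f) ((∑ R : Finset V, ((1 - t) / t) ^ R.card *
      ((∑ v, phi μ f (insert v R) t) - TT μ f R t)) / t) t := by
  have hr : HasDerivAt (fun t : ℝ => (1 - t) / t) (-(1 / t ^ 2)) t := by
    have := ((hasDerivAt_id t).const_sub 1).div (hasDerivAt_id t) ht.ne'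
    refine this.congr_deriv (Eq.symm ?_)
    simp only [id]
    field_simp
    ring
  have h1 : HasDerivAt (fun t => (∑ σ, μ σ * (f σ * Real.log (f σ)))
    - ∑ R : Finset V, ((1 - t) / t) ^ R.card * phi μ f R t) _ t :=
    (HasDerivAt.fun_sum fun R (_ : R ∈ Finset.univ) =>
      (hr.pow R.card).mul (dphi hμ hf R ht)).const_sub _
  have h2 : EE μ f =ᶠ[nhds t] (fun t => (∑ σ, μ σ * (f σ * Real.log (f σ)))
    - ∑ R : Finset V, ((1 - t) / t) ^ R.card * phi μ f R t) := by
    filter_upwards [lt_mem_nhds ht] with x hx using E_eq x hx.ne'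
  refine (h1.congr_of_eventuallyEq h2).congr_deriv (Eq.symm ?_)
  simp only [mul_sub, Finset.sum_sub_distrib, Pi.pow_apply]
  rw [← reindex2 (fun R => phi μ f R t) ht.ne', Finset.sum_add_distrib, neg_add, sub_div,
    sub_eq_add_neg]
  congr 1
  · rw [div_div, ← sq, Finset.sum_div, ← Finset.sum_neg_distrib]
    refine Finset.sum_congr rfl fun R _ => ?_
    ring
  · rw [Finset.sum_div]
    congr 1
    refine Finset.sum_congr rfl fun R _ => ?_
    ring

lemma loss {κ : ℝ} (hκ : 0 < κ) (hμ : ∀ σ, 0 ≤ μ σ) (hf : ∀ σ, 0 < f σ)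
    (h : ∀ lam : V → ℝ, (∀ v, 0 < lam v) →
      Good κ (fun σ => μ σ * ∏ v : V, if σ v then lam v else 1))
    (R : Finset V) {t : ℝ} (ht : 0 < t) :
    (∑ v, phi μ f (insert v R) t) - TT μ f R t ≤ κ * (kk μ f R t - phi μ f R t) := by
  by_cases h0 : aa μ R t = 0
  · obtain ⟨z1, z2, z3, z4⟩ := zero_all (f := f) hμ ht h0 t
    simp [phi, TT, z1, z2, z3, fun v => (z4 v).1, fun v => (z4 v).2]
  · have ha : 0 < aa μ R t := (SS_nonneg μ hμ R ht).lt_of_ne' h0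
    set w : Conf V → ℝ := fun σ => if ∀ v ∈ R, σ v = true then μ σ * t ^ plusCount σ else 0 with hw
    have hmul : ∀ (g : Conf V → ℝ) σ, w σ * g σ
        = if ∀ v ∈ R, σ v = true then μ σ * g σ * t ^ plusCount σ else 0 := by
      intro g σ
      simp only [hw]
      split_ifs
      · ring
      · ring
    have hw0 : ∀ σ, 0 ≤ w σ := by
      intro σ
      simp only [hw]
      split_ifs
      · exact mul_nonneg (hμ σ) (pow_pos ht _).le
      · exact le_rfl
    have hgood : ∀ lam : V → ℝ, (∀ v, 0 < lam v) →
      Good κ (fun σ => w σ * ∏ v : V, if σ v then lam v else 1) := by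
      intro lam hl
      have := good_R μ h R (fun v => t * lam v) (fun v => mul_pos ht (hl v))
      convert this using 2 with σ
      rw [hmul (fun σ => ∏ v : V, if σ v = true then lam v else 1) σ]
      refine if_congr Iff.rfl ?_ rfl
      have e : (∏ v : V, if σ v = true then t * lam v else 1)
          = (∏ v : V, if σ v = true then lam v else 1) * t ^ plusCount σ := by
        have e' : t ^ plusCount σ = ∏ v : V, if σ v = true then t else 1 := by
          rw [Finset.prod_ite]; simp [plusCount, plusSet]
        rw [e', ← Finset.prod_mul_distrib]
        refine Finset.prod_congr rfl fun v _ => ?_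
        split_ifs <;> ring
      rw [e]; ring
    have hEI := EI hκ w hw0 ha hgood f hf (aa μ R t) (bb μ f R t) (fun v => aa μ (insert v R) t)
      (fun v => bb μ f (insert v R) t) rfl
      (Finset.sum_congr rfl fun σ _ => (hmul f σ).symm)
      (fun v => Finset.sum_congr rfl fun σ _ => ite_insert _ _ _ _)
      (fun v => Finset.sum_congr rfl fun σ _ => by rw [hmul f σ]; exact ite_insert _ _ _ _)
    have ek : (∑ σ, w σ * (f σ * Real.log (f σ))) = kk μ f R t :=
      Finset.sum_congr rfl fun σ _ => hmul (fun σ => f σ * Real.log (f σ)) σ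
    rw [ek] at hEI
    refine le_trans (le_of_eq ?_) hEI
    unfold TT
    rw [← Finset.sum_sub_distrib]
    refine Finset.sum_congr rfl fun v _ => ?_
    unfold phi
    ring

lemma E_decay {κ : ℝ} (hκ : 0 < κ) (hμ : ∀ σ, 0 ≤ μ σ) (hf : ∀ σ, 0 < f σ)
    (h : ∀ lam : V → ℝ, (∀ v, 0 < lam v) →
      Good κ (fun σ => μ σ * ∏ v : V, if σ v then lam v else 1))
    {θ : ℝ} (h0 : 0 < θ) (h1 : θ < 1) : EE μ f 1 ≤ θ ^ (-κ) * EE μ f θ := by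
  have hE : ∀ t ∈ Set.Icc θ 1, HasDerivAt (fun t => t ^ (-κ) * EE μ f t) _ t := fun t ht =>
    (Real.hasDerivAt_rpow_const (p := -κ) (Or.inl (h0.trans_le ht.1).ne')).mul
      (dE hμ hf (h0.trans_le ht.1))
  have hanti : AntitoneOn (fun t => t ^ (-κ) * EE μ f t) (Set.Icc θ 1) := by
    refine antitoneOn_of_deriv_nonpos (convex_Icc θ 1)
      (fun t ht => (hE t ht).continuousAt.continuousWithinAt)
      (fun t ht => (hE t (interior_subset ht)).differentiableAt.differentiableWithinAt) ?_
    intro t ht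
    have ht' := interior_subset ht
    have htp := h0.trans_le ht'.1
    rw [(hE t ht').deriv]
    have hle : (∑ R : Finset V, ((1 - t) / t) ^ R.card *
      ((∑ v, phi μ f (insert v R) t) - TT μ f R t)) ≤ κ * EE μ f t := by
      unfold EE
      rw [Finset.mul_sum]
      refine Finset.sum_le_sum fun R _ => ?_
      rw [mul_left_comm]
      refine mul_le_mul_of_nonneg_left (loss hκ hμ hf h R htp) ?_
      exact pow_nonneg (div_nonneg (by linarith [ht'.2]) htp.le) _
    set S := (∑ R : Finset V, ((1 - t) / t) ^ R.card *
      ((∑ v, phi μ f (insert v R) t) - TT μ f R t))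
    have e : t ^ (-κ) = t ^ (-κ - 1) * t := by
      rw [Real.rpow_sub_one htp.ne']; field_simp
    have : -κ * t ^ (-κ - 1) * EE μ f t + t ^ (-κ) * (S / t)
        = t ^ (-κ - 1) * (S - κ * EE μ f t) := by
      rw [e]; field_simp; ring
    rw [this]
    exact mul_nonpos_of_nonneg_of_nonpos (Real.rpow_nonneg htp.le _) (by linarith)
  have := hanti (Set.left_mem_Icc.2 h1.le) (Set.right_mem_Icc.2 h1.le) h1.le
  simpa using this

lemma E_one : EE μ f 1 = entOf μ f - (∑ σ, μ σ * f σ) * Real.log ((∑ σ, μ σ * f σ) / ∑ σ, μ σ)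
    + (∑ σ, μ σ * f σ) * Real.log (∑ σ, μ σ * f σ) := by
  rw [E_eq 1 one_ne_zero]
  rw [Finset.sum_eq_single (∅ : Finset V)]
  · simp [phi, bb, aa, SS, entOf]
    ring
  · intro R _ hR
    simp [Finset.card_ne_zero.2 (Finset.nonempty_iff_ne_empty.2 hR)]
  · simp

lemma ent_nonneg (hμ : ∀ σ, 0 ≤ μ σ) (hf : ∀ σ, 0 < f σ) (R : Finset V) {t : ℝ} (ht : 0 < t) :
    0 ≤ kk μ f R t - phi μ f R t := by
  by_cases h0 : aa μ R t = 0
  · obtain ⟨z1, z2, z3, z4⟩ := zero_all (f := f) hμ ht h0 t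
    simp [phi, z2, z3]
  have ha : 0 < aa μ R t := (SS_nonneg μ hμ R ht).lt_of_ne' h0
  have hb : 0 < bb μ f R t := SS_pos μ hμ f hf R ht ht ha
  set y := bb μ f R t / aa μ R t with hy
  have hyp : 0 < y := div_pos hb ha
  have h1 : bb μ f R t * Real.log y + bb μ f R t - y * aa μ R t ≤ kk μ f R t := by
    unfold bb aa kk SS
    rw [Finset.sum_mul, Finset.mul_sum, ← Finset.sum_add_distrib, ← Finset.sum_sub_distrib]
    refine Finset.sum_le_sum fun σ _ => ?_
    split_ifs
    · have := mul_le_mul_of_nonneg_left (flogf (hf σ) hyp)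
        (mul_nonneg (hμ σ) (pow_pos ht (plusCount σ)).le)
      linarith
    · simp
  have h2 : y * aa μ R t = bb μ f R t := by rw [hy]; field_simp
  unfold phi
  linarith

lemma E_nonneg (hμ : ∀ σ, 0 ≤ μ σ) (hf : ∀ σ, 0 < f σ) {t : ℝ} (ht : 0 < t) (ht1 : t < 1) :
    0 ≤ EE μ f t :=
  Finset.sum_nonneg fun R _ => mul_nonneg
    (pow_nonneg (div_nonneg (by linarith) ht.le) _) (ent_nonneg hμ hf R ht)

lemma prod_const_pow (σ : Conf V) (t : ℝ) :
    (∏ v : V, if σ v = true then t else 1) = t ^ plusCount σ := by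
  rw [Finset.prod_ite]; simp [plusCount, plusSet]

lemma mbf_eq (hμ : IsDist μ) {θ : ℝ} (h0 : 0 < θ) :
    (Zmag μ θ / θ ^ (Fintype.card V)) *
      ∑ R : Finset V, binWeight θ R * mbfTerm μ θ f R = EE μ f θ := by
  have hZ : 0 < Zmag μ θ := by
    have hn : ∀ σ, 0 ≤ μ σ * θ ^ plusCount σ := fun σ => mul_nonneg (hμ.1 σ) (pow_pos h0 _).le
    refine (Finset.sum_nonneg fun σ _ => hn σ).lt_of_ne fun hh => ?_
    have h1 := (Finset.sum_eq_zero_iff_of_nonneg fun τ _ => hn τ).1 hh.symm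
    have h2 : ∑ a, μ a = 0 := Finset.sum_eq_zero fun τ ht =>
      (mul_eq_zero.1 (h1 τ ht)).resolve_right (pow_pos h0 _).ne'
    rw [hμ.2] at h2; norm_num at h2
  have hmag : ∀ σ, magnetizeC μ θ σ = μ σ * θ ^ plusCount σ / Zmag μ θ := by
    intro σ
    unfold magnetizeC magnetize Zmag
    simp only [prod_const_pow]
  have hmar : ∀ R : Finset V, margin (magnetizeC μ θ) R (fun _ => true) = aa μ R θ / Zmag μ θ := by
    intro R
    unfold margin aa SS
    rw [Finset.sum_div]
    refine Finset.sum_congr rfl fun σ _ => ?_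
    rw [hmag]
    split_ifs <;> simp
  have hcond : ∀ (R : Finset V) (g : Conf V → ℝ), aa μ R θ ≠ 0 →
      (∑ σ, condDist (magnetizeC μ θ) R (fun _ => true) σ * g σ)
        = SS (fun σ => μ σ * g σ) R θ / aa μ R θ := by
    intro R g ha
    unfold condDist SS
    rw [Finset.sum_div]
    refine Finset.sum_congr rfl fun σ _ => ?_
    rw [hmag, hmar]
    split_ifs
    · field_simp
    · simp
  unfold EE
  rw [Finset.mul_sum]
  refine Finset.sum_congr rfl fun R _ => ?_
  have hterm : Zmag μ θ * mbfTerm μ θ f R = kk μ f R θ - phi μ f R θ := by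
    unfold mbfTerm
    rw [hmar]
    by_cases ha : aa μ R θ = 0
    · obtain ⟨z1, z2, z3, z4⟩ := zero_all (f := f) hμ.1 h0 ha θ
      simp [phi, z2, z3, ha]
    · unfold entOf
      rw [hcond R f ha, hcond R (fun σ => f σ * Real.log (f σ)) ha]
      unfold kk phi bb
      field_simp
  rw [← hterm]
  have hcard : R.card ≤ Fintype.card V := Finset.card_le_univ R
  have hp : θ ^ (Fintype.card V) = θ ^ (Fintype.card V - R.card) * θ ^ R.card := by
    rw [← pow_add, Nat.sub_add_cancel hcard]
  unfold binWeight
  rw [hp, div_pow]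
  field_simp

lemma ent_continuous {A : Type*} [Fintype A] (m g : A → ℝ) :
    Continuous fun ε : ℝ => entOf m (fun a => g a + ε) := by
  unfold entOf
  refine Continuous.sub ?_ ?_
  · refine continuous_finsetSum _ fun a _ => continuous_const.mul ?_
    exact Real.continuous_mul_log.comp (continuous_const.add continuous_id)
  · refine Real.continuous_mul_log.comp (f := fun ε : ℝ => ∑ a, m a * (g a + ε)) ?_
    fun_prop

end main

end MBFProof

/-- If every `k`-transformed distribution `μ_k` (`k ≥ 1`) is
`η`-spectrally independent in `∞`-norm with all fields, then for every `θ ∈ (0,1)`,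
`μ` satisfies `θ`-magnetized block factorization of entropy with `C = (e/θ)^{η+2}`. -/
theorem ktrans_si_implies_mbf {V : Type*} [Fintype V] [DecidableEq V]
    (μ : Conf V → ℝ) (hμ : IsDist μ) (η : ℝ) (hη : 0 < η)
    (hSI : ∀ k : ℕ, 1 ≤ k → SIinfAllFields (ktrans μ k) η) :
    ∀ θ : ℝ, 0 < θ → θ < 1 → MBF μ θ ((Real.exp 1 / θ) ^ (η + 2)) := by
  intro θ h0 h1 f hf
  have hκ : 0 < 1 + η := by linarith
  have hgood := MBFProof.good_all μ hμ (hSI 1 le_rfl)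
  have main : ∀ ε > 0, entOf μ (fun σ => f σ + ε) ≤
      (Real.exp 1 / θ) ^ (η + 2) * (Zmag μ θ / θ ^ (Fintype.card V)) *
      ∑ R : Finset V, binWeight θ R * mbfTerm μ θ (fun σ => f σ + ε) R := by
    intro ε hε
    have hf' : ∀ σ, 0 < f σ + ε := fun σ => add_pos_of_nonneg_of_pos (hf σ) hε
    rw [mul_assoc, MBFProof.mbf_eq hμ h0]
    have hd := MBFProof.E_decay hκ hμ.1 hf' hgood h0 h1
    rw [MBFProof.E_one, hμ.2, div_one, sub_add_cancel] at hd
    refine hd.trans (mul_le_mul_of_nonneg_right ?_ (MBFProof.E_nonneg hμ.1 hf' h0 h1))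
    have hθ1 : 1 ≤ 1 / θ := by rw [le_div_iff₀ h0]; linarith
    have he : (1:ℝ) ≤ Real.exp 1 := Real.one_le_exp (by norm_num)
    calc θ ^ (-(1 + η)) = (1 / θ) ^ (1 + η) := by
          rw [Real.rpow_neg h0.le, one_div, Real.inv_rpow h0.le]
      _ ≤ (1 / θ) ^ (η + 2) := Real.rpow_le_rpow_of_exponent_le hθ1 (by linarith)
      _ ≤ (Real.exp 1 / θ) ^ (η + 2) :=
          Real.rpow_le_rpow (by positivity) (by gcongr) (by linarith)
  have c1 := MBFProof.ent_continuous μ f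
  have c2 : Continuous fun ε : ℝ =>
      (Real.exp 1 / θ) ^ (η + 2) * (Zmag μ θ / θ ^ (Fintype.card V)) *
      ∑ R : Finset V, binWeight θ R * mbfTerm μ θ (fun σ => f σ + ε) R := by
    refine continuous_const.mul (continuous_finsetSum _ fun R _ => continuous_const.mul ?_)
    exact continuous_const.mul (MBFProof.ent_continuous _ f)
  have := le_of_tendsto_of_tendsto (b := nhdsWithin (0:ℝ) (Set.Ioi 0))
    ((c1.tendsto 0).mono_left nhdsWithin_le_nhds)
    ((c2.tendsto 0).mono_left nhdsWithin_le_nhds)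
    (by filter_upwards [self_mem_nhdsWithin] with ε hε using main ε hε)
  simpa using this
end
end
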